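/- The open interval (1, μ_{0 1̄}) of real numbers is the disjoint union of the set {μ_u : u ∈ S_{L,M,R}} and the union over all σ ∈ {L,M,R}*M of the closed intervals [μ_{σ(1 0̄)}, μ_{σ(01 0̄)}] and [μ_{σ(10 1̄)}, μ_{σ(0 1̄)}]; that is, (1, μ_{0 1̄}) = {μ_u : u ∈ S_{L,M,R}} ∪ ⋃_{σ ∈ {L,M,R}*M} ([μ_{σ(1 0̄)}, μ_{σ(01 0̄)}] ∪ [μ_{σ(10 1̄)}, μ_{σ(0 1̄)}]), and this is a partition. -/

import Mathlib

/-- `π_β(u)` for a binary sequence `u = u₁u₂⋯` (indexed from 0). -/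
noncomputable def piB (β : ℝ) (u : ℕ → Bool) : ℝ :=
  ∑' k : ℕ, (if u k then (1 : ℝ) else 0) / β ^ (k + 1)

/-- `π_β(u)` for a real digit sequence. -/
noncomputable def piR (β : ℝ) (u : ℕ → ℝ) : ℝ := ∑' k : ℕ, u k / β ^ (k + 1)

/-- A binary sequence viewed as a real digit sequence. -/
def bR (u : ℕ → Bool) : ℕ → ℝ := fun k => if u k then 1 else 0

/-- `U_β(A)`: sequences with digits in `A` whose `π_β`-value has no other expansion over `A`. -/
def Uset (β : ℝ) (A : Set ℝ) : Set (ℕ → ℝ) :=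
  {u | (∀ k, u k ∈ A) ∧ ∀ v : ℕ → ℝ, (∀ k, v k ∈ A) → v ≠ u → piR β v ≠ piR β u}

/-- `𝓛(m) = inf {β > 1 : U_β(m) ∩ {0,1}^ℕ is uncountable}`. -/
noncomputable def Lval (m : ℝ) : ℝ :=
  sInf {β : ℝ | 1 < β ∧ ¬ (Uset β {0, 1, m} ∩ {v | ∃ u : ℕ → Bool, v = bR u}).Countable}

/-- The shift orbit `O(u)` of an infinite binary word. -/
def orbit (u : ℕ → Bool) : Set (ℕ → Bool) := {v | ∃ k : ℕ, v = fun i => u (i + k)}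

/-- Suffixes of `u` preceded by the letter `1`. -/
def orbit1 (u : ℕ → Bool) : Set (ℕ → Bool) :=
  {v | ∃ k : ℕ, u k = true ∧ v = fun i => u (i + k + 1)}

/-- Suffixes of `u` preceded by the letter `0`. -/
def orbit0 (u : ℕ → Bool) : Set (ℕ → Bool) :=
  {v | ∃ k : ℕ, u k = false ∧ v = fun i => u (i + k + 1)}

open Classical in
/-- The lexicographic supremum of a set of binary sequences (greedy construction);
`⊥ = 0̄` for the empty set. -/
noncomputable def lexSupSeq (S : Set (ℕ → Bool)) : ℕ → Bool
  | n => decide (∃ u ∈ S, (∀ i, i < n → u i = lexSupSeq S i) ∧ u n = true)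
  termination_by n => n

open Classical in
/-- The lexicographic infimum of a set of binary sequences (greedy construction);
`⊤ = 1̄` for the empty set. -/
noncomputable def lexInfSeq (S : Set (ℕ → Bool)) : ℕ → Bool
  | n => decide (¬ ∃ u ∈ S, (∀ i, i < n → u i = lexInfSeq S i) ∧ u n = false)
  termination_by n => n

/-- `sup O(u)`, the lexicographically largest limit of suffixes of `u`. -/
noncomputable def supO (u : ℕ → Bool) : ℕ → Bool := lexSupSeq (orbit u)
/-- `inf O(u)`. -/
noncomputable def infO (u : ℕ → Bool) : ℕ → Bool := lexInfSeq (orbit u)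
/-- `sup₀(u)`, the supremum of the suffixes preceded by `0`. -/
noncomputable def sup0 (u : ℕ → Bool) : ℕ → Bool := lexSupSeq (orbit0 u)
/-- `inf₁(u)`, the infimum of the suffixes preceded by `1`. -/
noncomputable def inf1 (u : ℕ → Bool) : ℕ → Bool := lexInfSeq (orbit1 u)

/-- Strict lexicographic order on infinite binary words. -/
def lexLt (u v : ℕ → Bool) : Prop := ∃ n, (∀ i, i < n → u i = v i) ∧ u n < v n
/-- Lexicographic order on infinite binary words. -/
def lexLe (u v : ℕ → Bool) : Prop := lexLt u v ∨ u = v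

/-- `f_u(m)`: the unique `β ≥ 1` with `β·π_β(sup O(u)) = m`. -/
noncomputable def fVal (u : ℕ → Bool) (m : ℝ) : ℝ :=
  sInf {β : ℝ | 1 ≤ β ∧ β * piB β (supO u) = m}

/-- `g_u(m)`: the unique `β > 1` with `(β-1)(1+π_β(inf O(u))) = m`. -/
noncomputable def gVal (u : ℕ → Bool) (m : ℝ) : ℝ :=
  sInf {β : ℝ | 1 < β ∧ (β - 1) * (1 + piB β (infO u)) = m}

/-- `μ_u`: the unique `m ∈ (1,2]` with `f_u(m) = g_u(m)`. -/
noncomputable def muVal (u : ℕ → Bool) : ℝ :=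
  sInf {m : ℝ | 1 < m ∧ m ≤ 2 ∧ fVal u m = gVal u m}

/-- `u` contains at least two ones. -/
def TwoOnes (u : ℕ → Bool) : Prop := ∃ k l, k < l ∧ u k = true ∧ u l = true

/-- The substitution `L : 0 ↦ 0, 1 ↦ 01` (with `0 = false`, `1 = true`). -/
def Lsub : Bool → List Bool := fun b => if b then [false, true] else [false]
/-- The substitution `M : 0 ↦ 01, 1 ↦ 10`. -/
def Msub : Bool → List Bool := fun b => if b then [true, false] else [false, true]
/-- The substitution `R : 0 ↦ 01, 1 ↦ 1`. -/
def Rsub : Bool → List Bool := fun b => if b then [true] else [false, true]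
/-- The identity substitution. -/
def idSub : Bool → List Bool := fun b => [b]
/-- Composition of substitutions: `compSub σ τ = σ ∘ τ` (apply `τ` first). -/
def compSub (σ τ : Bool → List Bool) : Bool → List Bool := fun b => (τ b).flatMap σ

/-- The monoid `{L,M,R}*` generated by the three substitutions. -/
def LMRstar : Set (Bool → List Bool) :=
  {σ | ∃ l : List (Bool → List Bool),
    (∀ τ ∈ l, τ = Lsub ∨ τ = Msub ∨ τ = Rsub) ∧ σ = l.foldr compSub idSub}

/-- A substitution applied to an infinite word, `σ(u₁)σ(u₂)⋯`. -/
noncomputable def substApply (σ : Bool → List Bool) (u : ℕ → Bool) : ℕ → Bool := fun n =>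
  let k := sSup {k : ℕ | (∑ i ∈ Finset.range k, (σ (u i)).length) ≤ n}
  (σ (u k)).getD (n - ∑ i ∈ Finset.range k, (σ (u i)).length) false

/-- `u` is a limit word of the sequence of substitutions `σseq`. -/
def IsLimitWord (σseq : ℕ → Bool → List Bool) (u : ℕ → Bool) : Prop :=
  ∃ useq : ℕ → ℕ → Bool, useq 0 = u ∧ ∀ n, useq n = substApply (σseq n) (useq (n + 1))

/-- Primitivity of a sequence of substitutions in `{L,M,R}^ℕ`: no tail is constantly `L`
and no tail is constantly `R`. -/
def PrimitiveSeq (σseq : ℕ → Bool → List Bool) : Prop :=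
  (¬ ∃ k, ∀ n, k ≤ n → σseq n = Lsub) ∧ ¬ ∃ k, ∀ n, k ≤ n → σseq n = Rsub

/-- `S_{L,M,R}`: the set of limit words of primitive sequences of substitutions. -/
def Sset : Set (ℕ → Bool) :=
  {u | ∃ σseq : ℕ → Bool → List Bool,
    (∀ n, σseq n = Lsub ∨ σseq n = Msub ∨ σseq n = Rsub) ∧
    PrimitiveSeq σseq ∧ IsLimitWord σseq u}

/-- The word `1 0̄ = 1000⋯`. -/
def w10bar : ℕ → Bool := fun n => decide (n = 0)
/-- The word `0 1̄ = 0111⋯`. -/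
def w01bar : ℕ → Bool := fun n => decide (n ≠ 0)
/-- The word `01 0̄ = 01000⋯`. -/
def w010bar : ℕ → Bool := fun n => decide (n = 1)
/-- The word `10 1̄ = 10111⋯`. -/
def w101bar : ℕ → Bool := fun n => decide (n ≠ 1)
/-- The word `0̄`. -/
def w0bar : ℕ → Bool := fun _ => false
/-- The word `1̄`. -/
def w1bar : ℕ → Bool := fun _ => true

/-- Prepend a letter to an infinite word. -/
def consB (b : Bool) (u : ℕ → Bool) : ℕ → Bool := fun n =>
  match n with
  | 0 => b
  | Nat.succ k => u k

/-- Prepend a finite word to an infinite word. -/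
def appendW (w : List Bool) (v : ℕ → Bool) : ℕ → Bool := fun n =>
  if n < w.length then w.getD n false else v (n - w.length)

/-! ### Infinite words and the lexicographic order -/

/-- The word without its first letter. -/
def tailB (u : ℕ → Bool) : ℕ → Bool := fun n => u (n + 1)

@[simp] theorem consB_zero (b : Bool) (u : ℕ → Bool) : consB b u 0 = b := rfl

@[simp] theorem consB_succ (b : Bool) (u : ℕ → Bool) (n : ℕ) : consB b u (n + 1) = u n := rfl

@[simp] theorem tailB_consB (b : Bool) (u : ℕ → Bool) : tailB (consB b u) = u := rfl

theorem consB_tailB (u : ℕ → Bool) : consB (u 0) (tailB u) = u := by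
  funext n; cases n <;> rfl

theorem exists_consB (u : ℕ → Bool) : ∃ b v, u = consB b v := ⟨_, _, (consB_tailB u).symm⟩

theorem eq_consB_of_zero {u : ℕ → Bool} {b : Bool} (h : u 0 = b) : ∃ v, u = consB b v :=
  ⟨tailB u, by rw [← h, consB_tailB]⟩

theorem lexLe_iff_toLex {u v : ℕ → Bool} : lexLe u v ↔ toLex u ≤ toLex v :=
  (le_iff_lt_or_eq (a := toLex u) (b := toLex v)).symm

theorem lexLt_iff_toLex {u v : ℕ → Bool} : lexLt u v ↔ toLex u < toLex v := Iff.rfl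

theorem lexLe_refl (u : ℕ → Bool) : lexLe u u := Or.inr rfl

theorem lexLt.le {u v : ℕ → Bool} (h : lexLt u v) : lexLe u v := Or.inl h

theorem lexLe.trans {u v w : ℕ → Bool} (h : lexLe u v) (h' : lexLe v w) : lexLe u w := by
  rw [lexLe_iff_toLex] at *; exact h.trans h'

theorem lexLt.trans_le {u v w : ℕ → Bool} (h : lexLt u v) (h' : lexLe v w) : lexLt u w := by
  rw [lexLe_iff_toLex] at *; rw [lexLt_iff_toLex] at *; exact h.trans_le h'

theorem lexLe_of_not_lexLt {u v : ℕ → Bool} (h : ¬ lexLt v u) : lexLe u v := by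
  rw [lexLe_iff_toLex]; rw [lexLt_iff_toLex] at h; exact not_lt.1 h

theorem lexLe.not_lexLt {u v : ℕ → Bool} (h : lexLe u v) : ¬ lexLt v u := by
  rw [lexLe_iff_toLex] at h; rw [lexLt_iff_toLex]; exact not_lt.2 h

theorem lexLt_false_true (u v : ℕ → Bool) : lexLt (consB false u) (consB true v) :=
  ⟨0, by simp, by simp⟩

@[simp] theorem lexLt_consB {b : Bool} {u v : ℕ → Bool} :
    lexLt (consB b u) (consB b v) ↔ lexLt u v := by
  constructor
  · rintro ⟨_ | n, h, h'⟩
    · simp at h'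
    · exact ⟨n, fun i hi => h (i + 1) (by omega), h'⟩
  · rintro ⟨n, h, h'⟩
    refine ⟨n + 1, fun i hi => ?_, h'⟩
    cases i with
    | zero => rfl
    | succ i => exact h i (by omega)

@[simp] theorem lexLe_consB {b : Bool} {u v : ℕ → Bool} :
    lexLe (consB b u) (consB b v) ↔ lexLe u v := by
  unfold lexLe
  rw [lexLt_consB]
  refine or_congr Iff.rfl ⟨fun h => ?_, fun h => by rw [h]⟩
  simpa using congrArg tailB h

theorem not_lexLe_true_false (u v : ℕ → Bool) : ¬ lexLe (consB true u) (consB false v) :=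
  fun h => h.not_lexLt (lexLt_false_true v u)

theorem lexLe_zero {u v : ℕ → Bool} (h : lexLe u v) (hu : u 0 = true) : v 0 = true := by
  obtain ⟨u, rfl⟩ := eq_consB_of_zero hu
  obtain ⟨b, v, rfl⟩ := exists_consB v
  cases b
  · exact absurd h (not_lexLe_true_false _ _)
  · rfl

theorem lexLe_zero_false {u v : ℕ → Bool} (h : lexLe u v) (hv : v 0 = false) : u 0 = false := by
  cases hu : u 0
  · rfl
  · rw [lexLe_zero h hu] at hv; exact hv

theorem lexLe_of_agree {u v : ℕ → Bool} (h : ∀ n, ∃ x, lexLe u x ∧ ∀ i < n, x i = v i) :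
    lexLe u v := by
  apply lexLe_of_not_lexLt
  rintro ⟨n, hn, hlt⟩
  obtain ⟨x, hx, hxv⟩ := h (n + 1)
  exact hx.not_lexLt ⟨n, fun i hi => (hxv i (by omega)).trans (hn i hi), by
    rw [hxv n (by omega)]; exact hlt⟩

theorem lexLe_of_agree' {u v : ℕ → Bool} (h : ∀ n, ∃ x, lexLe x v ∧ ∀ i < n, x i = u i) :
    lexLe u v := by
  apply lexLe_of_not_lexLt
  rintro ⟨n, hn, hlt⟩
  obtain ⟨x, hx, hxu⟩ := h (n + 1)
  exact hx.not_lexLt ⟨n, fun i hi => (hn i hi).trans (hxu i (by omega)).symm, by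
    rw [hxu n (by omega)]; exact hlt⟩

theorem w0bar_lexLe (u : ℕ → Bool) : lexLe w0bar u :=
  lexLe_iff_toLex.2 (Pi.toLex_monotone fun _ => bot_le)

theorem lexLe_w1bar (u : ℕ → Bool) : lexLe u w1bar :=
  lexLe_iff_toLex.2 (Pi.toLex_monotone fun _ => le_top)

theorem w0bar_eq : w0bar = consB false w0bar := by funext n; cases n <;> rfl

theorem w1bar_eq : w1bar = consB true w1bar := by funext n; cases n <;> rfl

theorem w10bar_eq : w10bar = consB true w0bar := by funext n; cases n <;> simp [w10bar, w0bar]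

theorem w01bar_eq : w01bar = consB false w1bar := by funext n; cases n <;> simp [w01bar, w1bar]

theorem w010bar_eq : w010bar = consB false w10bar := by
  funext n; cases n <;> simp [w010bar, w10bar]

theorem w101bar_eq : w101bar = consB true w01bar := by
  funext n; cases n <;> simp [w101bar, w01bar]

/-! ### Lexicographic suprema and infima -/

theorem lexSupSeq_eq (S : Set (ℕ → Bool)) (n : ℕ) : lexSupSeq S n = true ↔
    ∃ u ∈ S, (∀ i, i < n → u i = lexSupSeq S i) ∧ u n = true := by
  rw [lexSupSeq]; simp

theorem lexInfSeq_eq (S : Set (ℕ → Bool)) (n : ℕ) : lexInfSeq S n = false ↔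
    ∃ u ∈ S, (∀ i, i < n → u i = lexInfSeq S i) ∧ u n = false := by
  rw [lexInfSeq]; simp

theorem lexLe_lexSupSeq {S : Set (ℕ → Bool)} {u : ℕ → Bool} (hu : u ∈ S) :
    lexLe u (lexSupSeq S) := by
  apply lexLe_of_not_lexLt
  rintro ⟨n, hn, hlt⟩
  have h := Bool.lt_iff.1 hlt
  rw [(lexSupSeq_eq S n).2 ⟨u, hu, fun i hi => (hn i hi).symm, h.2⟩] at h
  simp at h

theorem lexInfSeq_lexLe {S : Set (ℕ → Bool)} {u : ℕ → Bool} (hu : u ∈ S) :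
    lexLe (lexInfSeq S) u := by
  apply lexLe_of_not_lexLt
  rintro ⟨n, hn, hlt⟩
  have h := Bool.lt_iff.1 hlt
  rw [(lexInfSeq_eq S n).2 ⟨u, hu, hn, h.1⟩] at h
  simp at h

theorem exists_agree_lexSupSeq {S : Set (ℕ → Bool)} (hS : S.Nonempty) (n : ℕ) :
    ∃ u ∈ S, ∀ i < n, u i = lexSupSeq S i := by
  induction n with
  | zero => exact ⟨hS.some, hS.some_mem, by simp⟩
  | succ n ih =>
    by_cases h : lexSupSeq S n = true
    · obtain ⟨u, hu, h1, h2⟩ := (lexSupSeq_eq S n).1 h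
      refine ⟨u, hu, fun i hi => ?_⟩
      rcases Nat.lt_succ_iff_lt_or_eq.1 hi with hi | rfl
      · exact h1 i hi
      · rw [h, h2]
    · obtain ⟨u, hu, h1⟩ := ih
      refine ⟨u, hu, fun i hi => ?_⟩
      rcases Nat.lt_succ_iff_lt_or_eq.1 hi with hi | rfl
      · exact h1 i hi
      · by_contra hne
        refine h ((lexSupSeq_eq S i).2 ⟨u, hu, h1, ?_⟩)
        cases hu' : u i
        · simp [hu'] at hne; exact absurd hne h
        · rfl

theorem exists_agree_lexInfSeq {S : Set (ℕ → Bool)} (hS : S.Nonempty) (n : ℕ) :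
    ∃ u ∈ S, ∀ i < n, u i = lexInfSeq S i := by
  induction n with
  | zero => exact ⟨hS.some, hS.some_mem, by simp⟩
  | succ n ih =>
    by_cases h : lexInfSeq S n = false
    · obtain ⟨u, hu, h1, h2⟩ := (lexInfSeq_eq S n).1 h
      refine ⟨u, hu, fun i hi => ?_⟩
      rcases Nat.lt_succ_iff_lt_or_eq.1 hi with hi | rfl
      · exact h1 i hi
      · rw [h, h2]
    · obtain ⟨u, hu, h1⟩ := ih
      refine ⟨u, hu, fun i hi => ?_⟩
      rcases Nat.lt_succ_iff_lt_or_eq.1 hi with hi | rfl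
      · exact h1 i hi
      · by_contra hne
        refine h ((lexInfSeq_eq S i).2 ⟨u, hu, h1, ?_⟩)
        cases hu' : u i
        · rfl
        · simp [hu'] at hne; exact absurd hne h

/-! ### Shift orbits -/

theorem mem_orbit_self (u : ℕ → Bool) : u ∈ orbit u := ⟨0, rfl⟩

theorem orbit_induction {v : ℕ → Bool} {P : (ℕ → Bool) → Prop} (h0 : P v)
    (h1 : ∀ b x, P (consB b x) → P x) {x : ℕ → Bool} (hx : x ∈ orbit v) : P x := by
  obtain ⟨k, rfl⟩ := hx
  induction k with
  | zero => exact h0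
  | succ k ih =>
    refine h1 (v k) _ ?_
    convert ih using 1
    funext n
    cases n with
    | zero => simp
    | succ n => simp only [consB_succ]; congr 1; omega

theorem mem_orbit_trans {u v w : ℕ → Bool} (h : u ∈ orbit v) (h' : v ∈ orbit w) :
    u ∈ orbit w := by
  obtain ⟨k, rfl⟩ := h
  obtain ⟨l, rfl⟩ := h'
  exact ⟨k + l, by funext i; simp only [add_assoc]⟩

theorem mem_orbit_consB (b : Bool) (u : ℕ → Bool) : u ∈ orbit (consB b u) := ⟨1, rfl⟩

theorem mem_orbit_of_consB {b : Bool} {u v : ℕ → Bool} (h : consB b u ∈ orbit v) :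
    u ∈ orbit v := mem_orbit_trans (mem_orbit_consB b u) h

/-! ### Substitutions on infinite words -/

@[simp] theorem appendW_nil (v : ℕ → Bool) : appendW [] v = v := by
  funext n; simp [appendW]

@[simp] theorem appendW_cons (b : Bool) (w : List Bool) (v : ℕ → Bool) :
    appendW (b :: w) v = consB b (appendW w v) := by
  funext n
  cases n with
  | zero => simp [appendW]
  | succ n => simp [appendW]

theorem appendW_append (w w' : List Bool) (v : ℕ → Bool) :
    appendW (w ++ w') v = appendW w (appendW w' v) := by
  induction w with
  | nil => simp
  | cons b w ih => simp [ih]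

theorem appendW_of_lt {w : List Bool} {v : ℕ → Bool} {n : ℕ} (h : n < w.length) :
    appendW w v n = w.getD n false := by simp only [appendW, if_pos h]

theorem appendW_of_le {w : List Bool} {v : ℕ → Bool} {n : ℕ} (h : w.length ≤ n) :
    appendW w v n = v (n - w.length) := by simp only [appendW, if_neg (not_lt.2 h)]

/-- A substitution mapping no letter to the empty word. -/
def Nonerasing (σ : Bool → List Bool) : Prop := ∀ b, 0 < (σ b).length

theorem substApply_apply {σ : Bool → List Bool} {u : ℕ → Bool} {n k : ℕ}
    (h1 : ∑ i ∈ Finset.range k, (σ (u i)).length ≤ n)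
    (h2 : n < ∑ i ∈ Finset.range (k + 1), (σ (u i)).length) :
    substApply σ u n =
      (σ (u k)).getD (n - ∑ i ∈ Finset.range k, (σ (u i)).length) false := by
  have hk : sSup {k : ℕ | (∑ i ∈ Finset.range k, (σ (u i)).length) ≤ n} = k := by
    have hub : ∀ l ∈ {k : ℕ | (∑ i ∈ Finset.range k, (σ (u i)).length) ≤ n}, l ≤ k := by
      intro l hl
      by_contra hlt
      have := Finset.sum_le_sum_of_subset (f := fun i => (σ (u i)).length)
        (Finset.range_mono (show k + 1 ≤ l by omega))
      simp only [Set.mem_ofPred_eq] at hl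
      omega
    exact le_antisymm (csSup_le ⟨k, h1⟩ hub) (le_csSup ⟨k, hub⟩ h1)
  simp only [substApply, hk]

theorem exists_block {σ : Bool → List Bool} (hσ : Nonerasing σ) (u : ℕ → Bool) (n : ℕ) :
    ∃ k, ∑ i ∈ Finset.range k, (σ (u i)).length ≤ n ∧
      n < ∑ i ∈ Finset.range (k + 1), (σ (u i)).length := by
  induction n with
  | zero => exact ⟨0, by simp, by simpa using hσ _⟩
  | succ n ih =>
    obtain ⟨k, h1, h2⟩ := ih
    by_cases h : n + 1 < ∑ i ∈ Finset.range (k + 1), (σ (u i)).length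
    · exact ⟨k, by omega, h⟩
    · refine ⟨k + 1, by omega, ?_⟩
      rw [Finset.sum_range_succ]
      have := hσ (u (k + 1))
      omega

theorem substApply_consB {σ : Bool → List Bool} (hσ : Nonerasing σ) (b : Bool) (v : ℕ → Bool) :
    substApply σ (consB b v) = appendW (σ b) (substApply σ v) := by
  funext n
  by_cases hn : n < (σ b).length
  · rw [appendW_of_lt hn, substApply_apply (k := 0) (by simp) (by simpa using hn)]
    simp
  · rw [appendW_of_le (not_lt.1 hn)]
    obtain ⟨k, h1, h2⟩ := exists_block hσ v (n - (σ b).length)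
    have hs : ∀ k, ∑ i ∈ Finset.range (k + 1), (σ (consB b v i)).length =
        (∑ i ∈ Finset.range k, (σ (v i)).length) + (σ b).length := fun k => by
      rw [Finset.sum_range_succ']; simp
    rw [substApply_apply h1 h2, substApply_apply (k := k + 1) (by rw [hs]; omega)
      (by rw [hs]; omega), hs, consB_succ]
    congr 1
    omega

theorem eq_of_consB_rec {σ : Bool → List Bool} (hσ : Nonerasing σ)
    {F G : (ℕ → Bool) → ℕ → Bool} (hF : ∀ b v, F (consB b v) = appendW (σ b) (F v))
    (hG : ∀ b v, G (consB b v) = appendW (σ b) (G v)) (u : ℕ → Bool) : F u = G u := by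
  have key : ∀ n u, F u n = G u n := by
    intro n
    induction n using Nat.strong_induction_on with
    | _ n ih =>
      intro u
      obtain ⟨b, v, rfl⟩ := exists_consB u
      rw [hF, hG]
      by_cases hn : n < (σ b).length
      · rw [appendW_of_lt hn, appendW_of_lt hn]
      · rw [appendW_of_le (not_lt.1 hn), appendW_of_le (not_lt.1 hn)]
        have := hσ b
        exact ih _ (by omega) v
  exact funext fun n => key n u

theorem nonerasing_idSub : Nonerasing idSub := fun b => by simp [idSub]

theorem Nonerasing.compSub {σ τ : Bool → List Bool} (hσ : Nonerasing σ) (hτ : Nonerasing τ) :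
    Nonerasing (compSub σ τ) := fun b => by
  have h := hτ b
  obtain ⟨c, l, hc⟩ := List.exists_cons_of_length_pos h
  have := hσ c
  simp only [_root_.compSub, hc, List.flatMap_cons, List.length_append]
  omega

theorem substApply_appendW {σ : Bool → List Bool} (hσ : Nonerasing σ) (w : List Bool)
    (v : ℕ → Bool) :
    substApply σ (appendW w v) = appendW (w.flatMap σ) (substApply σ v) := by
  induction w with
  | nil => simp
  | cons b w ih => simp [substApply_consB hσ, ih, appendW_append]

theorem substApply_compSub {σ τ : Bool → List Bool} (hσ : Nonerasing σ) (hτ : Nonerasing τ)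
    (u : ℕ → Bool) : substApply (compSub σ τ) u = substApply σ (substApply τ u) :=
  eq_of_consB_rec (σ := compSub σ τ) (hσ.compSub hτ) (substApply_consB (hσ.compSub hτ))
    (G := fun u => substApply σ (substApply τ u))
    (fun b v => by simp only [substApply_consB hτ, substApply_appendW hσ, compSub]) u

theorem substApply_idSub (u : ℕ → Bool) : substApply idSub u = u :=
  eq_of_consB_rec nonerasing_idSub (substApply_consB nonerasing_idSub) (G := id)
    (fun b v => by simp [idSub]) u

/-- Labels for the substitutions `L`, `M`, `R`. -/
inductive LMR : Type
  | L
  | M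
  | R

namespace LMR

/-- The substitution with a given label. -/
def sub : LMR → Bool → List Bool
  | L => Lsub
  | M => Msub
  | R => Rsub

theorem nonerasing_sub (c : LMR) : Nonerasing c.sub := by
  intro b; cases c <;> cases b <;> simp [sub, Lsub, Msub, Rsub]

/-- The action of the substitution with a given label on infinite words. -/
noncomputable def ap (c : LMR) (u : ℕ → Bool) : ℕ → Bool := substApply c.sub u

@[simp] theorem ap_L_false (u : ℕ → Bool) : ap L (consB false u) = consB false (ap L u) := by
  rw [ap, substApply_consB (nonerasing_sub _)]; simp [sub, Lsub, ap]

@[simp] theorem ap_L_true (u : ℕ → Bool) :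
    ap L (consB true u) = consB false (consB true (ap L u)) := by
  rw [ap, substApply_consB (nonerasing_sub _)]; simp [sub, Lsub, ap]

@[simp] theorem ap_M_false (u : ℕ → Bool) :
    ap M (consB false u) = consB false (consB true (ap M u)) := by
  rw [ap, substApply_consB (nonerasing_sub _)]; simp [sub, Msub, ap]

@[simp] theorem ap_M_true (u : ℕ → Bool) :
    ap M (consB true u) = consB true (consB false (ap M u)) := by
  rw [ap, substApply_consB (nonerasing_sub _)]; simp [sub, Msub, ap]

@[simp] theorem ap_R_false (u : ℕ → Bool) :
    ap R (consB false u) = consB false (consB true (ap R u)) := by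
  rw [ap, substApply_consB (nonerasing_sub _)]; simp [sub, Rsub, ap]

@[simp] theorem ap_R_true (u : ℕ → Bool) : ap R (consB true u) = consB true (ap R u) := by
  rw [ap, substApply_consB (nonerasing_sub _)]; simp [sub, Rsub, ap]

theorem ap_L_zero (u : ℕ → Bool) : ap L u 0 = false := by
  obtain ⟨b, v, rfl⟩ := exists_consB u
  cases b <;> simp

theorem ap_lexLt (c : LMR) {u v : ℕ → Bool} (h : lexLt u v) : lexLt (ap c u) (ap c v) := by
  obtain ⟨n, h, h'⟩ := h
  induction n generalizing u v with
  | zero =>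
    obtain ⟨b, u, rfl⟩ := exists_consB u
    obtain ⟨b', v, rfl⟩ := exists_consB v
    have := Bool.lt_iff.1 h'
    simp only [consB_zero] at this
    obtain ⟨rfl, rfl⟩ := this
    cases c
    · obtain ⟨u', hu⟩ := eq_consB_of_zero (ap_L_zero u)
      simp [hu, lexLt_false_true]
    · simp [lexLt_false_true]
    · simp [lexLt_false_true]
  | succ n ih =>
    obtain ⟨b, u, rfl⟩ := exists_consB u
    obtain ⟨b', v, rfl⟩ := exists_consB v
    obtain rfl : b = b' := h 0 (by omega)
    have := ih (u := u) (v := v) (fun i hi => h (i + 1) (by omega)) h'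
    cases c <;> cases b <;> simpa using this

theorem ap_lexLe (c : LMR) {u v : ℕ → Bool} (h : lexLe u v) : lexLe (ap c u) (ap c v) := by
  rcases h with h | rfl
  · exact (ap_lexLt c h).le
  · exact lexLe_refl _

theorem mem_orbit_ap (c : LMR) {u v : ℕ → Bool} (h : u ∈ orbit v) : ap c u ∈ orbit (ap c v) := by
  refine orbit_induction (P := fun u => ap c u ∈ orbit (ap c v)) (mem_orbit_self _) ?_ h
  intro b x hx
  cases c <;> cases b <;> simp only [ap_L_false, ap_L_true, ap_M_false, ap_M_true, ap_R_false,
    ap_R_true] at hx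
  all_goals first
    | exact mem_orbit_of_consB hx
    | exact mem_orbit_of_consB (mem_orbit_of_consB hx)

theorem orbit_ap_L {v z : ℕ → Bool} (h : z ∈ orbit (ap L v)) :
    (∃ x ∈ orbit v, z = ap L x) ∨
      ∃ x, consB true x ∈ orbit v ∧ z = consB true (ap L x) := by
  refine orbit_induction (P := fun z => (∃ x ∈ orbit v, z = ap L x) ∨
      ∃ x, consB true x ∈ orbit v ∧ z = consB true (ap L x))
    (Or.inl ⟨v, mem_orbit_self v, rfl⟩) ?_ h
  rintro b z (⟨x, hx, hz⟩ | ⟨x, hx, hz⟩)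
  · obtain ⟨d, y, rfl⟩ := exists_consB x
    replace hz := congrArg tailB hz
    cases d
    · exact Or.inl ⟨y, mem_orbit_of_consB hx, by simpa using hz⟩
    · exact Or.inr ⟨y, hx, by simpa using hz⟩
  · exact Or.inl ⟨x, mem_orbit_of_consB hx, by simpa using congrArg tailB hz⟩

theorem orbit_ap_M {v z : ℕ → Bool} (h : z ∈ orbit (ap M v)) :
    (∃ x ∈ orbit v, z = ap M x) ∨
      ∃ b x, consB b x ∈ orbit v ∧ z = consB (!b) (ap M x) := by
  refine orbit_induction (P := fun z => (∃ x ∈ orbit v, z = ap M x) ∨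
      ∃ b x, consB b x ∈ orbit v ∧ z = consB (!b) (ap M x))
    (Or.inl ⟨v, mem_orbit_self v, rfl⟩) ?_ h
  rintro b z (⟨x, hx, hz⟩ | ⟨d, x, hx, hz⟩)
  · obtain ⟨d, y, rfl⟩ := exists_consB x
    replace hz := congrArg tailB hz
    cases d <;> exact Or.inr ⟨_, y, hx, by simpa using hz⟩
  · exact Or.inl ⟨x, mem_orbit_of_consB hx, by simpa using congrArg tailB hz⟩

theorem orbit_ap_R {v z : ℕ → Bool} (h : z ∈ orbit (ap R v)) :
    (∃ x ∈ orbit v, z = ap R x) ∨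
      ∃ x, consB false x ∈ orbit v ∧ z = consB true (ap R x) := by
  refine orbit_induction (P := fun z => (∃ x ∈ orbit v, z = ap R x) ∨
      ∃ x, consB false x ∈ orbit v ∧ z = consB true (ap R x))
    (Or.inl ⟨v, mem_orbit_self v, rfl⟩) ?_ h
  rintro b z (⟨x, hx, hz⟩ | ⟨x, hx, hz⟩)
  · obtain ⟨d, y, rfl⟩ := exists_consB x
    replace hz := congrArg tailB hz
    cases d
    · exact Or.inr ⟨y, hx, by simpa using hz⟩
    · exact Or.inl ⟨y, mem_orbit_of_consB hx, by simpa using hz⟩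
  · exact Or.inl ⟨x, mem_orbit_of_consB hx, by simpa using congrArg tailB hz⟩

end LMR

/-- Two words have the same first `n` letters. -/
def Agree (n : ℕ) (u v : ℕ → Bool) : Prop := ∀ i < n, u i = v i

theorem Agree.mono {m n : ℕ} {u v : ℕ → Bool} (h : Agree n u v) (hmn : m ≤ n) : Agree m u v :=
  fun i hi => h i (by omega)

@[simp] theorem agree_consB {n : ℕ} {b : Bool} {u v : ℕ → Bool} :
    Agree (n + 1) (consB b u) (consB b v) ↔ Agree n u v := by
  constructor
  · exact fun h i hi => h (i + 1) (by omega)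
  · rintro h (_ | i) hi
    · rfl
    · exact h i (by omega)

theorem agree_zero (u v : ℕ → Bool) : Agree 0 u v := fun i hi => by omega

namespace LMR

theorem agree_ap (c : LMR) {n : ℕ} {u v : ℕ → Bool} (h : Agree n u v) :
    Agree n (ap c u) (ap c v) := by
  induction n generalizing u v with
  | zero => exact agree_zero _ _
  | succ n ih =>
    obtain ⟨b, u, rfl⟩ := exists_consB u
    obtain ⟨b', v, rfl⟩ := exists_consB v
    obtain rfl : b = b' := h 0 (by omega)
    have := ih (agree_consB.1 h)
    cases c <;> cases b <;> simp only [ap_L_false, ap_L_true, ap_M_false, ap_M_true, ap_R_false,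
      ap_R_true, agree_consB]
    all_goals first
      | exact this
      | exact (agree_consB (n := n)).2 this |>.mono (by omega)

theorem agree_ap_L {n : ℕ} {u v : ℕ → Bool} (h : Agree n u v) :
    Agree (n + 1) (ap L u) (ap L v) := by
  induction n generalizing u v with
  | zero =>
    intro i hi
    obtain rfl : i = 0 := by omega
    rw [ap_L_zero, ap_L_zero]
  | succ n ih =>
    obtain ⟨b, u, rfl⟩ := exists_consB u
    obtain ⟨b', v, rfl⟩ := exists_consB v
    obtain rfl : b = b' := h 0 (by omega)
    have := ih (agree_consB.1 h)
    cases b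
    · simpa using this
    · simpa using this.mono (Nat.le_succ n)

end LMR

/-! ### The action of the substitutions on pairs (supremum, infimum) -/

/-- A pair `(s, i)` that may serve as `(sup O(u), inf O(u))`. -/
structure Admissible (p : (ℕ → Bool) × (ℕ → Bool)) : Prop where
  fst_zero : p.1 0 = true
  snd_zero : p.2 0 = false
  le_tail : lexLe p.2 (tailB p.1)

theorem Admissible.exists_eq {p : (ℕ → Bool) × (ℕ → Bool)} (hp : Admissible p) :
    ∃ s i, p = (consB true s, consB false i) ∧ lexLe (consB false i) s := by
  obtain ⟨s, i⟩ := p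
  obtain ⟨s, rfl⟩ := eq_consB_of_zero hp.fst_zero
  obtain ⟨i, rfl⟩ := eq_consB_of_zero hp.snd_zero
  exact ⟨s, i, rfl, hp.le_tail⟩

namespace LMR

/-- The action on suprema of orbits. -/
noncomputable def upper : LMR → (ℕ → Bool) → ℕ → Bool
  | L, s => tailB (ap L s)
  | M, s => consB true (ap M s)
  | R, s => consB true (ap R s)

/-- The action on infima of orbits. -/
noncomputable def lower : LMR → (ℕ → Bool) → ℕ → Bool
  | L, i => ap L i
  | M, i => consB false (ap M i)
  | R, i => ap R i

/-- The action on pairs (supremum, infimum). -/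
noncomputable def act (c : LMR) (p : (ℕ → Bool) × (ℕ → Bool)) : (ℕ → Bool) × (ℕ → Bool) :=
  (upper c p.1, lower c p.2)

theorem admissible_act (c : LMR) {p : (ℕ → Bool) × (ℕ → Bool)} (hp : Admissible p) :
    Admissible (act c p) := by
  obtain ⟨s, i, rfl, h⟩ := hp.exists_eq
  cases c
  · exact ⟨by simp [act, upper], by simp [act, lower],
      by simpa [act, upper, lower] using ap_lexLe L h⟩
  · exact ⟨by simp [act, upper], by simp [act, lower],
      by simpa [act, upper, lower] using (lexLt_false_true _ _).le⟩
  · exact ⟨by simp [act, upper], by simp [act, lower],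
      by simpa [act, upper, lower] using (lexLt_false_true _ _).le⟩

theorem lower_lexLe (c : LMR) {i j : ℕ → Bool} (h : lexLe i j) :
    lexLe (lower c i) (lower c j) := by
  cases c
  · exact ap_lexLe L h
  · simpa [lower] using ap_lexLe M h
  · exact ap_lexLe R h

theorem upper_lexLt (c : LMR) {s t : ℕ → Bool} (hs : s 0 = true) (h : lexLt s t) :
    lexLt (upper c s) (upper c t) := by
  obtain ⟨t, rfl⟩ := eq_consB_of_zero (lexLe_zero h.le hs)
  obtain ⟨s, rfl⟩ := eq_consB_of_zero hs
  rw [lexLt_consB] at h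
  have := ap_lexLt c h
  cases c <;> simpa [upper] using this

theorem upper_lexLe (c : LMR) {s t : ℕ → Bool} (hs : s 0 = true) (h : lexLe s t) :
    lexLe (upper c s) (upper c t) := by
  rcases h with h | rfl
  · exact (upper_lexLt c hs h).le
  · exact lexLe_refl _

theorem agree_upper (c : LMR) {n : ℕ} {s t : ℕ → Bool} (hs : s 0 = true) (ht : t 0 = true)
    (h : Agree (n + 1) s t) : Agree (n + 2) (upper c s) (upper c t) := by
  have h' := agree_ap c h
  obtain ⟨s, rfl⟩ := eq_consB_of_zero hs
  obtain ⟨t, rfl⟩ := eq_consB_of_zero ht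
  cases c
  · simpa [upper] using agree_ap_L (agree_consB.1 h)
  · exact agree_consB.2 h'
  · exact agree_consB.2 h'

theorem agree_lower (c : LMR) {n : ℕ} {i j : ℕ → Bool} (hi : i 0 = false) (hj : j 0 = false)
    (h : Agree (n + 1) i j) : Agree (n + 2) (lower c i) (lower c j) := by
  have h' := agree_ap c h
  have h'' := agree_ap c (agree_consB (b := false).1 (by
    rw [← consB_tailB i, ← consB_tailB j, hi, hj] at h; exact h))
  cases c
  · exact agree_ap_L h
  · exact agree_consB.2 h'
  · obtain ⟨i, rfl⟩ := eq_consB_of_zero hi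
    obtain ⟨j, rfl⟩ := eq_consB_of_zero hj
    simpa [lower] using h''

end LMR

open LMR

/-- The orbit of `v` has its supremum in `[p.1, q.1]` and its infimum in `[p.2, q.2]`; the bounds
`p.1` and `q.2` are witnessed by suffixes of `v`. -/
def OrbitBetween (v : ℕ → Bool) (p q : (ℕ → Bool) × (ℕ → Bool)) : Prop :=
  (∀ x ∈ orbit v, lexLe p.2 x ∧ lexLe x q.1) ∧
    (∃ x ∈ orbit v, lexLe p.1 x) ∧ ∃ x ∈ orbit v, lexLe x q.2

/-- Variant of `OrbitBetween` where the witness for `p.1` is preceded by `0` and the witness for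
`q.2` is preceded by `1`. -/
def OrbitBetweenInner (v : ℕ → Bool) (p q : (ℕ → Bool) × (ℕ → Bool)) : Prop :=
  (∀ x ∈ orbit v, lexLe p.2 x ∧ lexLe x q.1) ∧
    (∃ x, consB false x ∈ orbit v ∧ lexLe p.1 x) ∧ ∃ x, consB true x ∈ orbit v ∧ lexLe x q.2

theorem OrbitBetweenInner.orbitBetween {v : ℕ → Bool} {p q : (ℕ → Bool) × (ℕ → Bool)}
    (h : OrbitBetweenInner v p q) : OrbitBetween v p q := by
  obtain ⟨h, ⟨x, hx, hx'⟩, y, hy, hy'⟩ := h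
  exact ⟨h, ⟨x, mem_orbit_of_consB hx, hx'⟩, y, mem_orbit_of_consB hy, hy'⟩

theorem OrbitBetweenInner.ap {v : ℕ → Bool} {p q : (ℕ → Bool) × (ℕ → Bool)}
    (h : OrbitBetweenInner v p q) (hp : Admissible p) (hq : Admissible q) (c : LMR) :
    OrbitBetweenInner (ap c v) (act c p) (act c q) := by
  obtain ⟨s, i, rfl, -⟩ := hp.exists_eq
  obtain ⟨t, j, rfl, -⟩ := hq.exists_eq
  obtain ⟨h, ⟨x, hx, hsx⟩, y, hy, hyj⟩ := h
  have hapx := mem_orbit_ap c hx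
  have hapy := mem_orbit_ap c hy
  refine ⟨fun z hz => ?_, ?_, ?_⟩
  · cases c
    · rcases orbit_ap_L hz with ⟨x, hx, rfl⟩ | ⟨x, hx, rfl⟩
      · refine ⟨by simpa [act, lower] using ap_lexLe L (h x hx).1, ?_⟩
        obtain ⟨w, hw⟩ := eq_consB_of_zero (ap_L_zero x)
        simpa [act, upper, hw] using (lexLt_false_true _ _).le
      · refine ⟨by simpa [act, lower] using (lexLt_false_true _ _).le, ?_⟩
        have := (h _ hx).2
        simp only [lexLe_consB] at this
        simpa [act, upper] using ap_lexLe L this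
    · rcases orbit_ap_M hz with ⟨x, hx, rfl⟩ | ⟨b, x, hx, rfl⟩
      · obtain ⟨b, x, rfl⟩ := exists_consB x
        cases b <;> simp [act, upper, lower, (lexLt_false_true _ _).le]
      · have hx' := h _ (mem_orbit_of_consB hx)
        have h1 := ap_lexLe M hx'.1
        have h2 := ap_lexLe M hx'.2
        cases b
        · simpa [act, upper, lower, (lexLt_false_true _ _).le] using h2
        · simpa [act, upper, lower, (lexLt_false_true _ _).le] using h1
    · rcases orbit_ap_R hz with ⟨x, hx, rfl⟩ | ⟨x, hx, rfl⟩
      · refine ⟨by simpa [act, lower] using ap_lexLe R (h x hx).1, ?_⟩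
        obtain ⟨b, x, rfl⟩ := exists_consB x
        cases b
        · simpa [act, upper] using (lexLt_false_true _ _).le
        · have := ap_lexLe R (h _ (mem_orbit_of_consB hx)).2
          simpa [act, upper] using this
      · refine ⟨by simpa [act, lower] using (lexLt_false_true _ _).le, ?_⟩
        have := ap_lexLe R (h _ (mem_orbit_of_consB hx)).2
        simpa [act, upper] using this
  · obtain ⟨x, rfl⟩ := eq_consB_of_zero (lexLe_zero hsx rfl)
    have := ap_lexLe c hsx
    cases c
    · rw [ap_L_false, ap_L_true] at hapx
      exact ⟨_, mem_orbit_of_consB hapx, by simpa [act, upper] using this⟩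
    · rw [ap_M_false] at hapx
      exact ⟨_, hapx, by simpa [act, upper] using this⟩
    · rw [ap_R_false] at hapx
      exact ⟨_, hapx, by simpa [act, upper] using this⟩
  · have := ap_lexLe c hyj
    cases c
    · rw [ap_L_true] at hapy
      exact ⟨_, mem_orbit_of_consB hapy, this⟩
    · rw [ap_M_true] at hapy
      exact ⟨_, hapy, by simpa [act, lower] using this⟩
    · rw [ap_R_true] at hapy
      exact ⟨_, hapy, this⟩

theorem orbit_nonempty (v : ℕ → Bool) : (orbit v).Nonempty := ⟨v, mem_orbit_self v⟩

theorem infO_lexLe {u x : ℕ → Bool} (hx : x ∈ orbit u) : lexLe (infO u) x := lexInfSeq_lexLe hx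

theorem lexLe_supO {u x : ℕ → Bool} (hx : x ∈ orbit u) : lexLe x (supO u) := lexLe_lexSupSeq hx

theorem OrbitBetween.lexLe {v : ℕ → Bool} {p q : (ℕ → Bool) × (ℕ → Bool)}
    (h : OrbitBetween v p q) :
    (lexLe p.1 (supO v) ∧ lexLe p.2 (infO v)) ∧ lexLe (supO v) q.1 ∧ lexLe (infO v) q.2 := by
  obtain ⟨h, ⟨x, hx, hx'⟩, y, hy, hy'⟩ := h
  refine ⟨⟨hx'.trans (lexLe_supO hx), lexLe_of_agree fun n => ?_⟩,
    lexLe_of_agree' fun n => ?_, (infO_lexLe hy).trans hy'⟩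
  · obtain ⟨u, hu, hu'⟩ := exists_agree_lexInfSeq (orbit_nonempty v) n
    exact ⟨u, (h u hu).1, hu'⟩
  · obtain ⟨u, hu, hu'⟩ := exists_agree_lexSupSeq (orbit_nonempty v) n
    exact ⟨u, (h u hu).2, hu'⟩

theorem infO_lexLe_tailB_supO (v : ℕ → Bool) : lexLe (infO v) (tailB (supO v)) := by
  refine lexLe_of_agree fun n => ?_
  obtain ⟨u, hu, hu'⟩ := exists_agree_lexSupSeq (orbit_nonempty v) (n + 1)
  refine ⟨tailB u, infO_lexLe ?_, fun i hi => hu' (i + 1) (by omega)⟩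
  rw [← consB_tailB u] at hu
  exact mem_orbit_of_consB hu

theorem OrbitBetween.admissible {v : ℕ → Bool} {p q : (ℕ → Bool) × (ℕ → Bool)}
    (h : OrbitBetween v p q) (hp : Admissible p) (hq : Admissible q) :
    Admissible (supO v, infO v) :=
  ⟨lexLe_zero h.lexLe.1.1 hp.fst_zero, lexLe_zero_false h.lexLe.2.2 hq.snd_zero,
    infO_lexLe_tailB_supO v⟩

/-- Every suffix of the word contains the letter `1`. -/
def InfOnes (u : ℕ → Bool) : Prop := ∀ x ∈ orbit u, ∃ y, consB true y ∈ orbit x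

theorem InfOnes.of_mem_orbit {u x : ℕ → Bool} (h : InfOnes u) (hx : x ∈ orbit u) : InfOnes x :=
  fun _ hy => h _ (mem_orbit_trans hy hx)

theorem InfOnes.consB {u : ℕ → Bool} (h : InfOnes u) (b : Bool) : InfOnes (consB b u) := by
  intro x hx
  obtain ⟨k, rfl⟩ := hx
  cases k with
  | zero =>
    obtain ⟨y, hy⟩ := h u (mem_orbit_self u)
    exact ⟨y, mem_orbit_trans hy ⟨1, rfl⟩⟩
  | succ k => exact h _ ⟨k, rfl⟩

theorem exists_true_mem_orbit_ap (c : LMR) {x y : ℕ → Bool} (hy : consB true y ∈ orbit x) :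
    ∃ z, consB true z ∈ orbit (ap c x) := by
  have := mem_orbit_ap c hy
  cases c
  · rw [ap_L_true] at this; exact ⟨_, mem_orbit_of_consB this⟩
  · rw [ap_M_true] at this; exact ⟨_, this⟩
  · rw [ap_R_true] at this; exact ⟨_, this⟩

theorem InfOnes.ap {u : ℕ → Bool} (h : InfOnes u) (c : LMR) : InfOnes (ap c u) := by
  have key : ∀ x ∈ orbit u, ∃ y, _root_.consB true y ∈ orbit (LMR.ap c x) := fun x hx => by
    obtain ⟨y, hy⟩ := h x hx
    exact exists_true_mem_orbit_ap c hy
  intro z hz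
  cases c
  · rcases orbit_ap_L hz with ⟨x, hx, rfl⟩ | ⟨x, hx, rfl⟩
    · exact key x hx
    · exact ⟨_, mem_orbit_self _⟩
  · rcases orbit_ap_M hz with ⟨x, hx, rfl⟩ | ⟨b, x, hx, rfl⟩
    · exact key x hx
    · obtain ⟨y, hy⟩ := key x (mem_orbit_of_consB hx)
      exact ⟨y, mem_orbit_trans hy (mem_orbit_consB _ _)⟩
  · rcases orbit_ap_R hz with ⟨x, hx, rfl⟩ | ⟨x, hx, rfl⟩
    · exact key x hx
    · exact ⟨_, mem_orbit_self _⟩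

theorem InfOnes.upper {s : ℕ → Bool} (h : InfOnes s) (c : LMR) : InfOnes (upper c s) := by
  cases c
  · exact (h.ap L).of_mem_orbit ⟨1, rfl⟩
  · exact (h.ap M).consB _
  · exact (h.ap R).consB _

theorem infOnes_w1bar : InfOnes w1bar := by
  rintro x ⟨k, rfl⟩
  exact ⟨w1bar, ⟨0, by funext n; cases n <;> rfl⟩⟩

/-! ### Values of expansions -/

theorem summable_piB {β : ℝ} (hβ : 1 < β) (u : ℕ → Bool) :
    Summable fun k : ℕ => (if u k then (1 : ℝ) else 0) / β ^ (k + 1) := by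
  have h0 : 0 < β := by linarith
  refine Summable.of_nonneg_of_le (fun k => by positivity) (fun k => ?_)
    ((summable_nat_add_iff 1).2 (summable_geometric_of_lt_one (inv_nonneg.2 h0.le)
      (inv_lt_one_of_one_lt₀ hβ)))
  rw [inv_pow, div_eq_mul_inv]
  refine mul_le_of_le_one_left (by positivity) ?_
  split_ifs <;> norm_num

theorem piB_consB {β : ℝ} (hβ : 1 < β) (b : Bool) (u : ℕ → Bool) :
    piB β (consB b u) = ((if b then 1 else 0) + piB β u) / β := by
  have h0 : β ≠ 0 := by linarith
  rw [piB, (summable_piB hβ _).tsum_eq_zero_add, add_div, piB, ← tsum_div_const]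
  congr 1
  · cases b <;> simp
  · refine tsum_congr fun k => ?_
    rw [consB_succ, pow_succ _ (k + 1), div_div]

theorem piB_nonneg {β : ℝ} (hβ : 0 ≤ β) (u : ℕ → Bool) : 0 ≤ piB β u :=
  tsum_nonneg fun k => by positivity

theorem piB_compl {β : ℝ} (hβ : 1 < β) (u : ℕ → Bool) :
    piB β u + piB β (fun n => !u n) = 1 / (β - 1) := by
  have h0 : β ≠ 0 := by linarith
  rw [piB, piB, ← (summable_piB hβ _).tsum_add (summable_piB hβ _)]
  have : ∀ k : ℕ, (if u k then (1 : ℝ) else 0) / β ^ (k + 1) +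
      (if (!u k) then (1 : ℝ) else 0) / β ^ (k + 1) = β⁻¹ * β⁻¹ ^ k := by
    intro k
    rw [← pow_succ', inv_pow]
    cases u k <;> simp
  simp_rw [this]
  rw [tsum_mul_left, tsum_geometric_of_lt_one (by positivity) (inv_lt_one_of_one_lt₀ hβ)]
  have : β - 1 ≠ 0 := by linarith
  field_simp

theorem piB_le {β : ℝ} (hβ : 1 < β) (u : ℕ → Bool) : piB β u ≤ 1 / (β - 1) := by
  rw [← piB_compl hβ u]
  linarith [piB_nonneg (by linarith : 0 ≤ β) fun n => !u n]

theorem piB_le_one {β : ℝ} (hβ : 2 ≤ β) (u : ℕ → Bool) : piB β u ≤ 1 := by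
  refine (piB_le (by linarith) u).trans ?_
  rw [div_le_one (by linarith)]
  linarith

theorem piB_antitone {β β' : ℝ} (hβ : 1 < β) (h : β ≤ β') (u : ℕ → Bool) :
    piB β' u ≤ piB β u := by
  refine (summable_piB (by linarith) u).tsum_le_tsum (fun k => ?_) (summable_piB hβ u)
  have : 0 < β := by linarith
  gcongr

theorem piB_mono_of_lexLt {β : ℝ} (hβ : 2 ≤ β) {u v : ℕ → Bool} (h : lexLt u v) :
    piB β u ≤ piB β v := by
  have h1 : 1 < β := by linarith
  obtain ⟨n, h, h'⟩ := h
  induction n generalizing u v with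
  | zero =>
    obtain ⟨b, u, rfl⟩ := exists_consB u
    obtain ⟨b', v, rfl⟩ := exists_consB v
    have := Bool.lt_iff.1 h'
    simp only [consB_zero] at this
    obtain ⟨rfl, rfl⟩ := this
    rw [piB_consB h1, piB_consB h1]
    have := piB_le_one hβ u
    have := piB_nonneg (by linarith : 0 ≤ β) v
    gcongr ?_ / β
    simp only [Bool.false_eq_true, if_false, if_true]
    linarith
  | succ n ih =>
    obtain ⟨b, u, rfl⟩ := exists_consB u
    obtain ⟨b', v, rfl⟩ := exists_consB v
    obtain rfl : b = b' := h 0 (by omega)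
    have := ih (u := u) (v := v) (fun i hi => h (i + 1) (by omega)) h'
    rw [piB_consB h1, piB_consB h1]
    gcongr

theorem piB_mono {β : ℝ} (hβ : 2 ≤ β) {u v : ℕ → Bool} (h : lexLe u v) :
    piB β u ≤ piB β v := by
  rcases h with h | rfl
  · exact piB_mono_of_lexLt hβ h
  · exact le_rfl

theorem InfOnes.piB_pos {β : ℝ} (hβ : 1 < β) {u : ℕ → Bool} (h : InfOnes u) : 0 < piB β u := by
  have h0 : 0 < β := by linarith
  obtain ⟨y, k, hk⟩ := h u (mem_orbit_self u)
  have : u k = true := by simpa using (congrFun hk 0).symm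
  exact (summable_piB hβ u).tsum_pos (fun k => by positivity) k (by simp [this]; positivity)

theorem piB_lt_of_lexLt {β : ℝ} (hβ : 2 ≤ β) {u v : ℕ → Bool} (hv : InfOnes v)
    (h : lexLt u v) : piB β u < piB β v := by
  have h1 : 1 < β := by linarith
  obtain ⟨n, h, h'⟩ := h
  induction n generalizing u v with
  | zero =>
    obtain ⟨b, u, rfl⟩ := exists_consB u
    obtain ⟨b', v, rfl⟩ := exists_consB v
    have := Bool.lt_iff.1 h'
    simp only [consB_zero] at this
    obtain ⟨rfl, rfl⟩ := this
    rw [piB_consB h1, piB_consB h1]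
    have := piB_le_one hβ u
    have := (hv.of_mem_orbit (mem_orbit_consB _ _)).piB_pos h1
    gcongr ?_ / β
    simp only [Bool.false_eq_true, if_false, if_true]
    linarith
  | succ n ih =>
    obtain ⟨b, u, rfl⟩ := exists_consB u
    obtain ⟨b', v, rfl⟩ := exists_consB v
    obtain rfl : b = b' := h 0 (by omega)
    have := ih (u := u) (v := v) (hv.of_mem_orbit (mem_orbit_consB _ _))
      (fun i hi => h (i + 1) (by omega)) h'
    rw [piB_consB h1, piB_consB h1]
    gcongr

theorem piB_le_add_of_agree {β : ℝ} (hβ : 2 ≤ β) {n : ℕ} {u v : ℕ → Bool} (h : Agree n u v) :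
    piB β v ≤ piB β u + (1 / 2) ^ n := by
  have h1 : 1 < β := by linarith
  induction n generalizing u v with
  | zero =>
    have := piB_le_one hβ v
    have := piB_nonneg (by linarith : 0 ≤ β) u
    simp; linarith
  | succ n ih =>
    obtain ⟨b, u, rfl⟩ := exists_consB u
    obtain ⟨b', v, rfl⟩ := exists_consB v
    obtain rfl : b = b' := h 0 (by omega)
    have := ih (agree_consB.1 h)
    rw [piB_consB h1, piB_consB h1, pow_succ, div_add' _ _ _ (by linarith)]
    gcongr ?_ / β
    have : (1 / 2 : ℝ) ^ n * 2 ≤ (1 / 2) ^ n * β := by gcongr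
    linarith

theorem continuousOn_piB {a : ℝ} (ha : 1 < a) (u : ℕ → Bool) :
    ContinuousOn (fun β => piB β u) (Set.Ici a) := by
  have h0 : 0 < a := by linarith
  refine continuousOn_tsum (u := fun k : ℕ => a⁻¹ ^ (k + 1)) (fun k => ?_)
    ((summable_nat_add_iff 1).2 (summable_geometric_of_lt_one (inv_nonneg.2 h0.le)
      (inv_lt_one_of_one_lt₀ ha))) fun k β hβ => ?_
  · refine continuousOn_const.div (by fun_prop) fun β hβ => ?_
    have : 0 < β := h0.trans_le hβ
    positivity
  · have hβ' : a ≤ β := hβ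
    have : 0 < β := h0.trans_le hβ
    rw [Real.norm_of_nonneg (by positivity), inv_pow, ← one_div]
    gcongr
    split_ifs <;> norm_num

theorem mul_div_pow_succ {γ : ℝ} (hγ : 0 < γ) (d : ℝ) (k : ℕ) :
    γ * (d / γ ^ (k + 1)) = d / γ ^ k := by
  rw [pow_succ]; field_simp

theorem mul_piB_lt {β β' : ℝ} (hβ : 1 ≤ β) (h : β < β') {s : ℕ → Bool} {k : ℕ}
    (hk : s (k + 1) = true)
    (hs : Summable fun k : ℕ => (if s k then (1 : ℝ) else 0) / β ^ (k + 1)) :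
    β' * piB β' s < β * piB β s := by
  have h0 : 0 < β := by linarith
  have h0' : 0 < β' := by linarith
  rw [piB, piB, ← tsum_mul_left, ← tsum_mul_left]
  refine Summable.tsum_lt_tsum (i := k + 1) (fun k => ?_) ?_
    ((summable_piB (by linarith) s).mul_left β') (hs.mul_left β)
  · simp only [mul_div_pow_succ h0, mul_div_pow_succ h0']
    gcongr
  · simp only [mul_div_pow_succ h0, mul_div_pow_succ h0', hk, if_true]
    have := pow_lt_pow_left₀ h h0.le (Nat.succ_ne_zero k)
    exact one_div_lt_one_div_of_lt (by positivity) this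

theorem mul_piB_antitone {β β' : ℝ} (hβ : 1 < β) (h : β ≤ β') (s : ℕ → Bool) :
    β' * piB β' s ≤ β * piB β s := by
  have h0 : 0 < β := by linarith
  have h0' : 0 < β' := by linarith
  rw [piB, piB, ← tsum_mul_left, ← tsum_mul_left]
  refine Summable.tsum_le_tsum (fun k => ?_)
    ((summable_piB (by linarith) s).mul_left β') ((summable_piB hβ s).mul_left β)
  simp only [mul_div_pow_succ h0, mul_div_pow_succ h0']
  gcongr

theorem sub_one_mul_eq {β : ℝ} (hβ : 1 < β) (i : ℕ → Bool) :
    (β - 1) * (1 + piB β i) = 1 + (β - 1) * (1 - piB β fun n => !i n) := by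
  have := piB_compl hβ i
  have h : β - 1 ≠ 0 := by linarith
  rw [eq_div_iff h] at this
  linarith

theorem sub_one_mul_lt {β β' : ℝ} (hβ : 1 < β) (h : β < β') {i : ℕ → Bool}
    (hi : 1 < (β - 1) * (1 + piB β i)) :
    (β - 1) * (1 + piB β i) < (β' - 1) * (1 + piB β' i) := by
  rw [sub_one_mul_eq hβ] at hi ⊢
  rw [sub_one_mul_eq (hβ.trans h)]
  have h1 := piB_antitone hβ h.le fun n => !i n
  have h2 : 0 < 1 - piB β fun n => !i n := by
    by_contra hc
    nlinarith
  nlinarith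

theorem sub_one_mul_lt_of_two_le {β β' : ℝ} (hβ : 2 ≤ β) (h : β < β') (i : ℕ → Bool) :
    (β - 1) * (1 + piB β i) < (β' - 1) * (1 + piB β' i) := by
  rw [sub_one_mul_eq (by linarith), sub_one_mul_eq (by linarith)]
  have h1 := piB_antitone (by linarith) h.le fun n => !i n
  have h2 : piB β' (fun n => !i n) < 1 := by
    refine (piB_le (by linarith) _).trans_lt ?_
    rw [div_lt_one (by linarith)]
    linarith
  nlinarith

/-! ### The crossing value of a pair -/

/-- The two curves attached to `(s, i) = p` cross at base `β` and height `m`. -/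
def IsCrossing (p : (ℕ → Bool) × (ℕ → Bool)) (β m : ℝ) : Prop :=
  2 ≤ β ∧ β * piB β p.1 = m ∧ (β - 1) * (1 + piB β p.2) = m

theorem exists_isCrossing {p : (ℕ → Bool) × (ℕ → Bool)} (hp : Admissible p) :
    ∃ m β, IsCrossing p β m := by
  obtain ⟨s, i, rfl, h⟩ := hp.exists_eq
  set D : ℝ → ℝ := fun β =>
    (β - 1) * (1 + piB β (consB false i)) - β * piB β (consB true s) with hD
  have hcont : ContinuousOn D (Set.Icc 2 3) := by
    have h (u : ℕ → Bool) : ContinuousOn (fun β => piB β u) (Set.Icc 2 3) :=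
      (continuousOn_piB (by norm_num : (1 : ℝ) < 2) u).mono fun x hx => hx.1
    have h1 := h (consB false i)
    have h2 := h (consB true s)
    fun_prop
  have h2 : D 2 ≤ 0 := by
    have := piB_mono le_rfl h
    simp only [hD]
    rw [piB_consB (by norm_num) true]
    simp only [if_true]
    linarith
  have h3 : 0 ≤ D 3 := by
    have h1 := piB_le (by norm_num : (1 : ℝ) < 3) (consB true s)
    have h2 := piB_nonneg (by norm_num : (0 : ℝ) ≤ 3) (consB false i)
    norm_num at h1
    simp only [hD]
    linarith
  obtain ⟨β, hβ, hβ'⟩ := intermediate_value_Icc (by norm_num : (2 : ℝ) ≤ 3) hcont ⟨h2, h3⟩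
  exact ⟨β * piB β (consB true s), β, hβ.1, rfl, by simp only [hD] at hβ'; linarith⟩

/-- The height at which the two curves attached to a pair cross. -/
noncomputable def crossVal (p : (ℕ → Bool) × (ℕ → Bool)) : ℝ :=
  Classical.epsilon fun m => ∃ β, IsCrossing p β m

theorem crossVal_spec {p : (ℕ → Bool) × (ℕ → Bool)} (hp : Admissible p) :
    ∃ β, IsCrossing p β (crossVal p) := Classical.epsilon_spec (exists_isCrossing hp)

theorem IsCrossing.le_two {p : (ℕ → Bool) × (ℕ → Bool)} {β m : ℝ} (h : IsCrossing p β m) :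
    m ≤ 2 := by
  obtain ⟨h1, rfl, -⟩ := h
  have := piB_le (by linarith : 1 < β) p.1
  have h3 : 0 < β - 1 := by linarith
  calc β * piB β p.1 ≤ β * (1 / (β - 1)) := by gcongr
    _ ≤ 2 := by rw [mul_one_div, div_le_iff₀ h3]; linarith

theorem IsCrossing.le_three {p : (ℕ → Bool) × (ℕ → Bool)} {β m : ℝ} (h : IsCrossing p β m) :
    β ≤ 3 := by
  have h2 := h.le_two
  obtain ⟨h1, -, h3⟩ := h
  have := piB_nonneg (by linarith : 0 ≤ β) p.2
  nlinarith

theorem IsCrossing.le {p q : (ℕ → Bool) × (ℕ → Bool)} {β m β' m' : ℝ} (h : IsCrossing p β m)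
    (h' : IsCrossing q β' m') (h1 : lexLe p.1 q.1) (h2 : lexLe p.2 q.2) : m ≤ m' := by
  obtain ⟨hβ, hf, hg⟩ := h
  obtain ⟨hβ', hf', hg'⟩ := h'
  have h0 : 0 < β - 1 := by linarith
  rcases lt_trichotomy β β' with hlt | rfl | hlt
  · rw [← hg, ← hg']
    refine le_trans ?_ (sub_one_mul_lt_of_two_le hβ hlt q.2).le
    have := piB_mono hβ h2
    gcongr
  · rw [← hg, ← hg']
    have := piB_mono hβ h2
    gcongr
  · rw [← hf, ← hf']
    refine le_trans ?_ (mul_piB_antitone (by linarith) hlt.le q.1)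
    have := piB_mono hβ h1
    gcongr

theorem IsCrossing.lt {p q : (ℕ → Bool) × (ℕ → Bool)} {β m β' m' : ℝ} (h : IsCrossing p β m)
    (h' : IsCrossing q β' m') (hq : InfOnes q.1) (h1 : lexLt p.1 q.1) (h2 : lexLe p.2 q.2) :
    m < m' := by
  obtain ⟨hβ, hf, hg⟩ := h
  obtain ⟨hβ', hf', hg'⟩ := h'
  have h0 : 0 < β - 1 := by linarith
  rcases lt_or_ge β β' with hlt | hle
  · rw [← hg, ← hg']
    refine lt_of_le_of_lt ?_ (sub_one_mul_lt_of_two_le hβ hlt q.2)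
    have := piB_mono hβ h2
    gcongr
  · rw [← hf, ← hf']
    refine lt_of_lt_of_le ?_ (mul_piB_antitone (by linarith) hle q.1)
    have := piB_lt_of_lexLt hβ hq h1
    gcongr

theorem IsCrossing.le_add {p q : (ℕ → Bool) × (ℕ → Bool)} {β m β' m' : ℝ} {n : ℕ}
    (h : IsCrossing p β m) (h' : IsCrossing q β' m') (h1 : Agree n p.1 q.1)
    (h2 : Agree n p.2 q.2) : m' ≤ m + 3 * (1 / 2) ^ n := by
  have h3 := h.le_three
  obtain ⟨hβ, hf, hg⟩ := h
  obtain ⟨hβ', hf', hg'⟩ := h'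
  have h0 : 0 < β - 1 := by linarith
  have hpow : 0 < (1 / 2 : ℝ) ^ n := by positivity
  rcases lt_or_ge β' β with hlt | hle
  · rw [← hg, ← hg']
    have h4 := piB_le_add_of_agree hβ h2
    have h5 := sub_one_mul_lt_of_two_le hβ' hlt q.2
    nlinarith
  · rw [← hf, ← hf']
    have h4 := piB_le_add_of_agree hβ h1
    have h5 := mul_piB_antitone (by linarith) hle q.1
    nlinarith

theorem crossVal_le {p q : (ℕ → Bool) × (ℕ → Bool)} (hp : Admissible p) (hq : Admissible q)
    (h1 : lexLe p.1 q.1) (h2 : lexLe p.2 q.2) : crossVal p ≤ crossVal q :=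
  (crossVal_spec hp).choose_spec.le (crossVal_spec hq).choose_spec h1 h2

theorem crossVal_lt {p q : (ℕ → Bool) × (ℕ → Bool)} (hp : Admissible p) (hq : Admissible q)
    (hq' : InfOnes q.1) (h1 : lexLt p.1 q.1) (h2 : lexLe p.2 q.2) : crossVal p < crossVal q :=
  (crossVal_spec hp).choose_spec.lt (crossVal_spec hq).choose_spec hq' h1 h2

theorem crossVal_le_add {p q : (ℕ → Bool) × (ℕ → Bool)} (hp : Admissible p) (hq : Admissible q)
    {n : ℕ} (h1 : Agree n p.1 q.1) (h2 : Agree n p.2 q.2) :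
    crossVal q ≤ crossVal p + 3 * (1 / 2) ^ n :=
  (crossVal_spec hp).choose_spec.le_add (crossVal_spec hq).choose_spec h1 h2

theorem IsCrossing.crossVal_eq {p : (ℕ → Bool) × (ℕ → Bool)} {β m : ℝ} (hp : Admissible p)
    (h : IsCrossing p β m) : crossVal p = m := by
  obtain ⟨β', h'⟩ := crossVal_spec hp
  exact le_antisymm (h'.le h (lexLe_refl _) (lexLe_refl _)) (h.le h' (lexLe_refl _) (lexLe_refl _))

/-! ### Identification of `muVal` -/

theorem fVal_eq {u : ℕ → Bool} {k : ℕ} (hk : supO u (k + 1) = true) {β m : ℝ} (hβ : 1 ≤ β)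
    (hm : m ≠ 0) (h : β * piB β (supO u) = m) : fVal u m = β := by
  have hsum : ∀ {γ : ℝ}, γ * piB γ (supO u) = m →
      Summable fun k : ℕ => (if supO u k then (1 : ℝ) else 0) / γ ^ (k + 1) := fun hγ => by
    by_contra hc
    rw [piB, tsum_eq_zero_of_not_summable hc, mul_zero] at hγ
    exact hm hγ.symm
  have : {β : ℝ | 1 ≤ β ∧ β * piB β (supO u) = m} = {β} := by
    refine Set.eq_singleton_iff_unique_mem.2 ⟨⟨hβ, h⟩, fun γ hγ => ?_⟩
    obtain ⟨hγ1, hγ⟩ := hγ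
    rcases lt_trichotomy γ β with hlt | heq | hlt
    · exact absurd (mul_piB_lt hγ1 hlt hk (hsum hγ)) (by rw [h, hγ]; exact lt_irrefl m)
    · exact heq
    · exact absurd (mul_piB_lt hβ hlt hk (hsum h)) (by rw [h, hγ]; exact lt_irrefl m)
  rw [fVal, this, csInf_singleton]

theorem gVal_eq {u : ℕ → Bool} {β m : ℝ} (hβ : 1 < β) (hm : 1 < m)
    (h : (β - 1) * (1 + piB β (infO u)) = m) : gVal u m = β := by
  have : {β : ℝ | 1 < β ∧ (β - 1) * (1 + piB β (infO u)) = m} = {β} := by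
    refine Set.eq_singleton_iff_unique_mem.2 ⟨⟨hβ, h⟩, fun γ hγ => ?_⟩
    obtain ⟨hγ1, hγ⟩ := hγ
    rcases lt_trichotomy γ β with hlt | heq | hlt
    · exact absurd (sub_one_mul_lt hγ1 hlt (hm.trans_eq hγ.symm))
        (by rw [h, hγ]; exact lt_irrefl m)
    · exact heq
    · exact absurd (sub_one_mul_lt hβ hlt (hm.trans_eq h.symm))
        (by rw [h, hγ]; exact lt_irrefl m)
  rw [gVal, this, csInf_singleton]

theorem exists_base {m : ℝ} (hm : 1 < m) (i : ℕ → Bool) :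
    ∃ β, 1 < β ∧ (β - 1) * (1 + piB β i) = m := by
  have ha : 1 < (1 + m) / 2 := by linarith
  have hab : (1 + m) / 2 ≤ m + 1 := by linarith
  have hcont : ContinuousOn (fun β => (β - 1) * (1 + piB β i)) (Set.Icc ((1 + m) / 2) (m + 1)) := by
    have h1 : ContinuousOn (fun β => piB β i) (Set.Icc ((1 + m) / 2) (m + 1)) :=
      (continuousOn_piB ha i).mono fun x hx => hx.1
    fun_prop
  have h1 : ((1 + m) / 2 - 1) * (1 + piB ((1 + m) / 2) i) ≤ m := by
    have h1 := piB_le ha i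
    have h2 : 0 < (1 + m) / 2 - 1 := by linarith
    rw [le_div_iff₀ h2] at h1
    linarith
  have h2 : m ≤ (m + 1 - 1) * (1 + piB (m + 1) i) := by
    have := piB_nonneg (by linarith : 0 ≤ m + 1) i
    nlinarith
  obtain ⟨β, hβ, hβ'⟩ := intermediate_value_Icc hab hcont ⟨h1, h2⟩
  exact ⟨β, ha.trans_le hβ.1, hβ'⟩

theorem muVal_eq_of_isCrossing {u : ℕ → Bool} {β m : ℝ} {k : ℕ}
    (hk : supO u (k + 1) = true) (h : IsCrossing (supO u, infO u) β m) (hm : 1 < m) :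
    muVal u = m := by
  have h2 := h.le_two
  obtain ⟨hβ, hf, hg⟩ := h
  simp only at hf hg
  have hset : {m : ℝ | 1 < m ∧ m ≤ 2 ∧ fVal u m = gVal u m} = {m} := by
    refine Set.eq_singleton_iff_unique_mem.2 ⟨⟨hm, h2, ?_⟩, ?_⟩
    · rw [fVal_eq hk (by linarith) (by linarith) hf, gVal_eq (by linarith) hm hg]
    · rintro m' ⟨hm', -, heq⟩
      obtain ⟨γ, hγ, hγ'⟩ := exists_base hm' (infO u)
      rw [gVal_eq hγ hm' hγ'] at heq
      have hne : {β : ℝ | 1 ≤ β ∧ β * piB β (supO u) = m'}.Nonempty := by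
        by_contra hc
        rw [fVal, Set.not_nonempty_iff_eq_empty.1 hc, Real.sInf_empty] at heq
        linarith
      obtain ⟨δ, hδ, hδ'⟩ := hne
      rw [fVal_eq hk hδ (by linarith) hδ'] at heq
      obtain rfl := heq
      rcases lt_trichotomy δ β with hlt | rfl | hlt
      · have h3 := mul_piB_lt hγ.le hlt hk (summable_piB hγ _)
        have h4 := sub_one_mul_lt hγ hlt (hm'.trans_eq hγ'.symm)
        linarith
      · exact hγ'.symm.trans hg
      · have h3 := mul_piB_lt (by linarith) hlt hk (summable_piB (by linarith) _)
        have h4 := sub_one_mul_lt (by linarith) hlt (hm.trans_eq hg.symm)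
        linarith
  rw [muVal, hset, csInf_singleton]

theorem exists_succ_of_lexLt {s : ℕ → Bool} (h : lexLt w10bar s) : ∃ k, s (k + 1) = true := by
  obtain ⟨n, -, h'⟩ := h
  have := Bool.lt_iff.1 h'
  cases n with
  | zero => simp [w10bar] at this
  | succ n => exact ⟨n, this.2⟩

theorem muVal_eq {u : ℕ → Bool} (hu : Admissible (supO u, infO u))
    (h : lexLt w10bar (supO u)) : muVal u = crossVal (supO u, infO u) := by
  obtain ⟨k, hk⟩ := exists_succ_of_lexLt h
  obtain ⟨β, hβ⟩ := crossVal_spec hu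
  refine muVal_eq_of_isCrossing hk hβ ?_
  obtain ⟨s, hs⟩ := eq_consB_of_zero hu.fst_zero
  simp only at hs
  obtain ⟨hβ2, hf, -⟩ := hβ
  have h1 : 1 < β := by linarith
  rw [← hf]
  simp only
  rw [hs] at hk ⊢
  rw [piB_consB h1, mul_div_cancel₀ _ (by linarith)]
  have : 0 < piB β s := (summable_piB h1 s).tsum_pos (fun k => by positivity) k (by
    rw [consB_succ] at hk
    simp only [hk, if_true]
    positivity)
  simp only [if_true]
  linarith

theorem OrbitBetween.muVal_mem {v : ℕ → Bool} {p q : (ℕ → Bool) × (ℕ → Bool)}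
    (h : OrbitBetween v p q) (hp : Admissible p) (hq : Admissible q)
    (hv : lexLt w10bar (supO v)) : muVal v ∈ Set.Icc (crossVal p) (crossVal q) := by
  have hv' := h.admissible hp hq
  obtain ⟨⟨h1, h2⟩, h3, h4⟩ := h.lexLe
  rw [muVal_eq hv' hv]
  exact ⟨crossVal_le hp hv' h1 h2, crossVal_le hv' hq h3 h4⟩

theorem OrbitBetween.muVal_eq {v : ℕ → Bool} {p : (ℕ → Bool) × (ℕ → Bool)}
    (h : OrbitBetween v p p) (hp : Admissible p) (hp' : lexLt w10bar p.1) :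
    muVal v = crossVal p := by
  obtain ⟨h1, h2⟩ := h.muVal_mem hp hp (hp'.trans_le h.lexLe.1.1)
  exact le_antisymm h2 h1

/-! ### The tree of intervals -/

theorem eq_of_eq_consB_consB {a b : Bool} {x y : ℕ → Bool} (hx : x = consB a (consB b x))
    (hy : y = consB a (consB b y)) : x = y := by
  have key : ∀ n, x n = y n := by
    intro n
    induction n using Nat.strong_induction_on with
    | _ n ih =>
      rw [hx, hy]
      match n with
      | 0 => rfl
      | 1 => rfl
      | n + 2 => exact ih n (by omega)
  exact funext key

/-- The word `(01)^∞`. -/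
noncomputable def alternating : ℕ → Bool := ap M w0bar

theorem alternating_eq : alternating = consB false (consB true alternating) := by
  conv_lhs => rw [alternating, w0bar_eq, ap_M_false]
  rfl

theorem tailB_alternating : tailB alternating = consB true alternating := by
  conv_lhs => rw [alternating_eq, tailB_consB]

theorem ap_L_w0bar : ap L w0bar = w0bar := by
  have h : ap L w0bar = consB false (ap L w0bar) := by
    conv_lhs => rw [w0bar_eq, ap_L_false]
  refine eq_of_eq_consB_consB (a := false) (b := false) ?_ ?_
  · rw [← h, ← h]
  · rw [← w0bar_eq, ← w0bar_eq]

theorem ap_R_w1bar : ap R w1bar = w1bar := by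
  have h : ap R w1bar = consB true (ap R w1bar) := by
    conv_lhs => rw [w1bar_eq, ap_R_true]
  refine eq_of_eq_consB_consB (a := true) (b := true) ?_ ?_
  · rw [← h, ← h]
  · rw [← w1bar_eq, ← w1bar_eq]

theorem ap_L_w1bar : ap L w1bar = alternating := by
  refine eq_of_eq_consB_consB ?_ alternating_eq
  conv_lhs => rw [w1bar_eq, ap_L_true]

theorem ap_R_w0bar : ap R w0bar = alternating := by
  refine eq_of_eq_consB_consB ?_ alternating_eq
  conv_lhs => rw [w0bar_eq, ap_R_false]

theorem ap_M_w1bar : ap M w1bar = consB true alternating := by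
  refine eq_of_eq_consB_consB (a := true) (b := false) ?_ ?_
  · conv_lhs => rw [w1bar_eq, ap_M_true]
  · rw [← alternating_eq]

theorem ap_M_w0bar : ap M w0bar = alternating := rfl

theorem lexLt_w0bar_consB_true (u : ℕ → Bool) : lexLt w0bar (consB true u) := by
  rw [w0bar_eq]; exact lexLt_false_true _ _

theorem lexLt_consB_false_w1bar (u : ℕ → Bool) : lexLt (consB false u) w1bar := by
  rw [w1bar_eq]; exact lexLt_false_true _ _

/-- The pair `(1 0̄, 0̄)`. -/
def leftPair : (ℕ → Bool) × (ℕ → Bool) := (w10bar, w0bar)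

/-- The pair `(1̄, 0 1̄)`. -/
def rightPair : (ℕ → Bool) × (ℕ → Bool) := (w1bar, w01bar)

theorem admissible_leftPair : Admissible leftPair :=
  ⟨by simp [leftPair, w10bar], rfl, w0bar_lexLe _⟩

theorem admissible_rightPair : Admissible rightPair :=
  ⟨rfl, by simp [rightPair, w01bar], lexLe_w1bar _⟩

theorem act_L_leftPair : act L leftPair = leftPair := by
  simp [act, leftPair, upper, lower, w10bar_eq, ap_L_w0bar]

theorem act_R_rightPair : act R rightPair = rightPair := by
  simp [act, rightPair, upper, lower, w01bar_eq, ap_R_w1bar, ← w1bar_eq]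

theorem act_L_rightPair :
    act L rightPair = (consB true alternating, consB false alternating) := by
  simp only [act, rightPair, upper, lower, w01bar_eq, ap_L_false, ap_L_w1bar]
  rw [tailB_alternating]

theorem act_M_leftPair :
    act M leftPair = (consB true (consB true (consB false alternating)),
      consB false alternating) := by
  simp [act, leftPair, upper, lower, w10bar_eq, ap_M_w0bar]

theorem act_M_rightPair :
    act M rightPair = (consB true (consB true alternating),
      consB false (consB false (consB true (consB true alternating)))) := by
  simp [act, rightPair, upper, lower, w01bar_eq, ap_M_w1bar]

theorem act_R_leftPair :
    act R leftPair = (consB true (consB true alternating), alternating) := by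
  simp [act, leftPair, upper, lower, w10bar_eq, ap_R_w0bar]

/-- The composed action of a list of substitutions on pairs. -/
noncomputable def acts (l : List LMR) (p : (ℕ → Bool) × (ℕ → Bool)) :
    (ℕ → Bool) × (ℕ → Bool) := l.foldr act p

/-- The composed action of a list of substitutions on words. -/
noncomputable def aps (l : List LMR) (u : ℕ → Bool) : ℕ → Bool := l.foldr ap u

theorem acts_concat (l : List LMR) (c : LMR) (p : (ℕ → Bool) × (ℕ → Bool)) :
    acts (l ++ [c]) p = acts l (act c p) := by simp [acts]

theorem aps_concat (l : List LMR) (c : LMR) (u : ℕ → Bool) :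
    aps (l ++ [c]) u = aps l (ap c u) := by simp [aps]

theorem admissible_acts (l : List LMR) {p : (ℕ → Bool) × (ℕ → Bool)} (hp : Admissible p) :
    Admissible (acts l p) := by
  induction l with
  | nil => exact hp
  | cons c l ih => exact admissible_act c ih

theorem acts_lexLt (l : List LMR) {p q : (ℕ → Bool) × (ℕ → Bool)} (hp : Admissible p)
    (h : lexLt p.1 q.1) : lexLt (acts l p).1 (acts l q).1 := by
  induction l with
  | nil => exact h
  | cons c l ih => exact upper_lexLt c (admissible_acts l hp).fst_zero ih

theorem acts_lexLe_fst (l : List LMR) {p q : (ℕ → Bool) × (ℕ → Bool)} (hp : Admissible p)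
    (h : lexLe p.1 q.1) : lexLe (acts l p).1 (acts l q).1 := by
  induction l with
  | nil => exact h
  | cons c l ih => exact upper_lexLe c (admissible_acts l hp).fst_zero ih

theorem acts_lexLe_snd (l : List LMR) {p q : (ℕ → Bool) × (ℕ → Bool)}
    (h : lexLe p.2 q.2) : lexLe (acts l p).2 (acts l q).2 := by
  induction l with
  | nil => exact h
  | cons c l ih => exact lower_lexLe c ih

theorem InfOnes.acts (l : List LMR) {p : (ℕ → Bool) × (ℕ → Bool)} (h : InfOnes p.1) :
    InfOnes (acts l p).1 := by
  induction l with
  | nil => exact h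
  | cons c l ih => exact ih.upper c

theorem crossVal_acts_lt (l : List LMR) {p q : (ℕ → Bool) × (ℕ → Bool)} (hp : Admissible p)
    (hq : Admissible q) (hq' : InfOnes q.1) (h1 : lexLt p.1 q.1) (h2 : lexLe p.2 q.2) :
    crossVal (acts l p) < crossVal (acts l q) :=
  crossVal_lt (admissible_acts l hp) (admissible_acts l hq) (hq'.acts l) (acts_lexLt l hp h1)
    (acts_lexLe_snd l h2)

theorem crossVal_acts_le (l : List LMR) {p q : (ℕ → Bool) × (ℕ → Bool)} (hp : Admissible p)
    (hq : Admissible q) (h1 : lexLe p.1 q.1) (h2 : lexLe p.2 q.2) :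
    crossVal (acts l p) ≤ crossVal (acts l q) :=
  crossVal_le (admissible_acts l hp) (admissible_acts l hq) (acts_lexLe_fst l hp h1)
    (acts_lexLe_snd l h2)

/-- The left end point of the interval attached to a list of substitutions. -/
noncomputable def lo (l : List LMR) : ℝ := crossVal (acts l leftPair)

/-- The right end point of the interval attached to a list of substitutions. -/
noncomputable def hi (l : List LMR) : ℝ := crossVal (acts l rightPair)

theorem lo_L (l : List LMR) : lo (l ++ [L]) = lo l := by
  rw [lo, acts_concat, act_L_leftPair, lo]

theorem hi_R (l : List LMR) : hi (l ++ [R]) = hi l := by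
  rw [hi, acts_concat, act_R_rightPair, hi]

theorem lo_lt_hi_L (l : List LMR) : lo l < hi (l ++ [L]) := by
  rw [lo, hi, acts_concat]
  refine crossVal_acts_lt l admissible_leftPair (admissible_act L admissible_rightPair)
    (infOnes_w1bar.upper L) ?_ (w0bar_lexLe _)
  rw [act_L_rightPair, leftPair, w10bar_eq, lexLt_consB, alternating_eq, w0bar_eq, lexLt_consB]
  exact lexLt_w0bar_consB_true _

theorem hi_L_le_lo_M (l : List LMR) : hi (l ++ [L]) ≤ lo (l ++ [M]) := by
  rw [lo, hi, acts_concat, acts_concat]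
  refine crossVal_acts_le l (admissible_act L admissible_rightPair)
    (admissible_act M admissible_leftPair) ?_ ?_
  · rw [act_L_rightPair, act_M_leftPair, lexLe_consB, alternating_eq]
    exact (lexLt_false_true _ _).le
  · rw [act_L_rightPair, act_M_leftPair]
    exact lexLe_refl _

theorem lo_lt_hi (l : List LMR) : lo l < hi l := by
  refine crossVal_acts_lt l admissible_leftPair admissible_rightPair infOnes_w1bar ?_
    (w0bar_lexLe _)
  rw [leftPair, rightPair, w10bar_eq, w1bar_eq, w0bar_eq, lexLt_consB]
  exact lexLt_consB_false_w1bar _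

theorem hi_M_le_lo_R (l : List LMR) : hi (l ++ [M]) ≤ lo (l ++ [R]) := by
  rw [lo, hi, acts_concat, acts_concat]
  refine crossVal_acts_le l (admissible_act M admissible_rightPair)
    (admissible_act R admissible_leftPair) ?_ ?_
  · rw [act_M_rightPair, act_R_leftPair]
    exact lexLe_refl _
  · rw [act_M_rightPair, act_R_leftPair, alternating_eq, lexLe_consB]
    exact (lexLt_false_true _ _).le

theorem lo_R_lt_hi (l : List LMR) : lo (l ++ [R]) < hi l := by
  rw [← hi_R]; exact lo_lt_hi _

theorem agree_acts (l : List LMR) :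
    Agree (l.length + 1) (acts l leftPair).1 (acts l rightPair).1 ∧
      Agree (l.length + 1) (acts l leftPair).2 (acts l rightPair).2 := by
  induction l with
  | nil =>
    constructor
    · rintro i hi
      obtain rfl : i = 0 := by simpa using hi
      rfl
    · rintro i hi
      obtain rfl : i = 0 := by simpa using hi
      rfl
  | cons c l ih =>
    have h1 := admissible_acts l admissible_leftPair
    have h2 := admissible_acts l admissible_rightPair
    exact ⟨agree_upper c h1.fst_zero h2.fst_zero ih.1, agree_lower c h1.snd_zero h2.snd_zero ih.2⟩

theorem hi_le_lo_add (l : List LMR) : hi l ≤ lo l + 3 * (1 / 2) ^ (l.length + 1) :=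
  crossVal_le_add (admissible_acts l admissible_leftPair) (admissible_acts l admissible_rightPair)
    (agree_acts l).1 (agree_acts l).2

theorem lo_nil : lo [] = 1 := by
  have h0 : piB 2 w0bar = 0 := by simp [piB, w0bar]
  refine IsCrossing.crossVal_eq (β := 2) admissible_leftPair ⟨le_rfl, ?_, ?_⟩
  · simp only [acts, List.foldr_nil, leftPair, w10bar_eq]
    rw [piB_consB one_lt_two, h0]
    norm_num
  · simp only [acts, List.foldr_nil, leftPair, h0]
    norm_num

/-! ### The words at the end points -/

theorem OrbitBetweenInner.aps {v : ℕ → Bool} {p q : (ℕ → Bool) × (ℕ → Bool)}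
    (h : OrbitBetweenInner v p q) (hp : Admissible p) (hq : Admissible q) (l : List LMR) :
    OrbitBetweenInner (aps l v) (acts l p) (acts l q) := by
  induction l with
  | nil => exact h
  | cons c l ih => exact ih.ap (admissible_acts l hp) (admissible_acts l hq) c

theorem lexLt_w10bar_upper (c : LMR) {s : ℕ → Bool} (h : lexLt w10bar s) :
    lexLt w10bar (upper c s) := by
  rw [w10bar_eq] at h ⊢
  obtain ⟨s, rfl⟩ := eq_consB_of_zero (lexLe_zero h.le rfl)
  rw [lexLt_consB] at h
  cases c
  · have := ap_lexLt L h
    rw [ap_L_w0bar] at this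
    simpa [upper] using this
  · simpa [upper] using lexLt_w0bar_consB_true _
  · simpa [upper] using lexLt_w0bar_consB_true _

theorem lexLt_w10bar_acts (l : List LMR) {p : (ℕ → Bool) × (ℕ → Bool)}
    (h : lexLt w10bar p.1) : lexLt w10bar (acts l p).1 := by
  induction l with
  | nil => exact h
  | cons c l ih => exact lexLt_w10bar_upper c ih

theorem muVal_aps {v : ℕ → Bool} {p : (ℕ → Bool) × (ℕ → Bool)} (h : OrbitBetweenInner v p p)
    (hp : Admissible p) (hp' : lexLt w10bar p.1) (l : List LMR) :
    muVal (aps l v) = crossVal (acts l p) :=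
  (h.aps hp hp l).orbitBetween.muVal_eq (admissible_acts l hp) (lexLt_w10bar_acts l hp')

theorem forall_orbit_consB {P : (ℕ → Bool) → Prop} {b : Bool} {v : ℕ → Bool} :
    (∀ x ∈ orbit (consB b v), P x) ↔ P (consB b v) ∧ ∀ x ∈ orbit v, P x := by
  refine ⟨fun h => ⟨h _ (mem_orbit_self _), fun x hx => h _ (mem_orbit_trans hx
    (mem_orbit_consB b v))⟩, fun h x hx => ?_⟩
  obtain ⟨k, rfl⟩ := hx
  cases k with
  | zero => exact h.1
  | succ k => exact h.2 _ ⟨k, rfl⟩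

theorem forall_orbit_w0bar {P : (ℕ → Bool) → Prop} : (∀ x ∈ orbit w0bar, P x) ↔ P w0bar :=
  ⟨fun h => h _ (mem_orbit_self _), by rintro h x ⟨k, rfl⟩; exact h⟩

theorem forall_orbit_w1bar {P : (ℕ → Bool) → Prop} : (∀ x ∈ orbit w1bar, P x) ↔ P w1bar :=
  ⟨fun h => h _ (mem_orbit_self _), by rintro h x ⟨k, rfl⟩; exact h⟩

theorem forall_orbit_alternating {P : (ℕ → Bool) → Prop} (h0 : P alternating)
    (h1 : P (consB true alternating)) : ∀ x ∈ orbit alternating, P x := by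
  intro x hx
  suffices x = alternating ∨ x = consB true alternating by
    rcases this with rfl | rfl <;> assumption
  refine orbit_induction (P := fun x => x = alternating ∨ x = consB true alternating)
    (Or.inl rfl) ?_ hx
  rintro b x (h | h)
  · rw [alternating_eq] at h
    exact Or.inr (by simpa using congrArg tailB h)
  · exact Or.inl (by simpa using congrArg tailB h)

theorem lexLe_consB_false_true (u v : ℕ → Bool) : lexLe (consB false u) (consB true v) :=
  (lexLt_false_true u v).le

theorem lexLe_alternating_consB_true (v : ℕ → Bool) : lexLe alternating (consB true v) := by
  rw [alternating_eq]; exact lexLe_consB_false_true _ _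

theorem consB_false_alternating_lexLe : lexLe (consB false alternating) alternating := by
  conv_rhs => rw [alternating_eq]
  exact lexLe_consB.2 (lexLe_alternating_consB_true _)

theorem orbitBetweenInner_M_w10bar :
    OrbitBetweenInner (ap M w10bar) (act L rightPair) (act L rightPair) := by
  rw [act_L_rightPair, w10bar_eq, ap_M_true, ap_M_w0bar]
  refine ⟨?_, ⟨consB true alternating, ?_, lexLe_refl _⟩, consB false alternating,
    mem_orbit_self _, lexLe_refl _⟩
  · simp only [forall_orbit_consB]
    refine ⟨?_, ?_, forall_orbit_alternating ?_ ?_⟩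
    · exact ⟨lexLe_consB_false_true _ _, lexLe_consB.2 consB_false_alternating_lexLe⟩
    · exact ⟨lexLe_refl _, lexLe_consB_false_true _ _⟩
    · exact ⟨consB_false_alternating_lexLe, lexLe_alternating_consB_true _⟩
    · exact ⟨lexLe_consB_false_true _ _, lexLe_refl _⟩
  · rw [← alternating_eq]
    exact mem_orbit_trans (mem_orbit_consB _ _) (mem_orbit_consB _ _)

theorem orbitBetweenInner_M_w01bar :
    OrbitBetweenInner (ap M w01bar) (act R leftPair) (act R leftPair) := by
  rw [act_R_leftPair, w01bar_eq, ap_M_false, ap_M_w1bar]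
  refine ⟨?_, ⟨consB true (consB true alternating), mem_orbit_self _, lexLe_refl _⟩, alternating,
    mem_orbit_trans (mem_orbit_consB _ _) (mem_orbit_consB _ _), lexLe_refl _⟩
  simp only [forall_orbit_consB]
  have h := lexLe_alternating_consB_true alternating
  refine ⟨?_, ?_, ?_, forall_orbit_alternating ?_ ?_⟩
  · refine ⟨?_, lexLe_consB_false_true _ _⟩
    conv in (occs := 1) alternating => rw [alternating_eq]
    simpa using h
  · exact ⟨lexLe_alternating_consB_true _, lexLe_refl _⟩
  · exact ⟨h, lexLe_consB.2 h⟩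
  · exact ⟨lexLe_refl _, lexLe_alternating_consB_true _⟩
  · exact ⟨h, lexLe_consB.2 h⟩

theorem orbitBetweenInner_w010bar : OrbitBetweenInner w010bar leftPair leftPair := by
  simp only [leftPair]
  rw [w010bar_eq]
  refine ⟨?_, ⟨w10bar, mem_orbit_self _, lexLe_refl _⟩, w0bar, ?_, lexLe_refl _⟩
  · rw [w10bar_eq]
    simp only [forall_orbit_consB, forall_orbit_w0bar, w0bar_lexLe, true_and, and_true]
    exact ⟨lexLe_consB_false_true _ _, lexLe_refl _⟩
  · rw [← w10bar_eq]
    exact mem_orbit_consB _ _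

theorem orbitBetween_w01bar : OrbitBetween w01bar rightPair rightPair := by
  simp only [rightPair]
  refine ⟨?_, ⟨w1bar, ?_, lexLe_refl _⟩, w01bar, mem_orbit_self _, lexLe_refl _⟩
  · rw [w01bar_eq]
    simp only [forall_orbit_consB, forall_orbit_w1bar, lexLe_w1bar, and_true]
    exact lexLe_refl _
  · rw [w01bar_eq]
    exact mem_orbit_consB _ _

theorem orbitBetweenInner_w101bar : OrbitBetweenInner w101bar rightPair rightPair := by
  have h := orbitBetween_w01bar.1
  rw [w101bar_eq]
  refine ⟨forall_orbit_consB.2 ⟨⟨?_, lexLe_w1bar _⟩, h⟩, ⟨w1bar, ?_, lexLe_refl _⟩, w01bar,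
    mem_orbit_self _, lexLe_refl _⟩
  · simp only [rightPair]
    rw [w01bar_eq]
    exact lexLe_consB_false_true _ _
  · rw [← w01bar_eq]
    exact mem_orbit_consB _ _

theorem lexLt_w10bar_w1bar : lexLt w10bar w1bar := by
  rw [w10bar_eq, w1bar_eq, lexLt_consB, w1bar_eq]
  exact lexLt_w0bar_consB_true _

theorem muVal_w01bar : muVal w01bar = hi [] :=
  orbitBetween_w01bar.muVal_eq admissible_rightPair lexLt_w10bar_w1bar

theorem muVal_aps_M_w10bar (l : List LMR) : muVal (aps l (ap M w10bar)) = hi (l ++ [L]) := by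
  rw [hi, acts_concat]
  exact muVal_aps orbitBetweenInner_M_w10bar (admissible_act L admissible_rightPair)
    (lexLt_w10bar_upper L lexLt_w10bar_w1bar) l

theorem muVal_aps_M_w010bar (l : List LMR) : muVal (aps l (ap M w010bar)) = lo (l ++ [M]) := by
  rw [lo, acts_concat]
  refine muVal_aps (orbitBetweenInner_w010bar.ap admissible_leftPair admissible_leftPair M)
    (admissible_act M admissible_leftPair) ?_ l
  rw [act_M_leftPair, w10bar_eq, lexLt_consB]
  exact lexLt_w0bar_consB_true _

theorem muVal_aps_M_w101bar (l : List LMR) : muVal (aps l (ap M w101bar)) = hi (l ++ [M]) := by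
  rw [hi, acts_concat]
  exact muVal_aps (orbitBetweenInner_w101bar.ap admissible_rightPair admissible_rightPair M)
    (admissible_act M admissible_rightPair) (lexLt_w10bar_upper M lexLt_w10bar_w1bar) l

theorem muVal_aps_M_w01bar (l : List LMR) : muVal (aps l (ap M w01bar)) = lo (l ++ [R]) := by
  rw [lo, acts_concat]
  refine muVal_aps orbitBetweenInner_M_w01bar (admissible_act R admissible_leftPair) ?_ l
  rw [act_R_leftPair, w10bar_eq, lexLt_consB]
  exact lexLt_w0bar_consB_true _

theorem lo_lt_lo_concat (l : List LMR) {c : LMR} (hc : c ≠ L) : lo l < lo (l ++ [c]) := by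
  have h1 := lo_lt_hi_L l
  have h2 := hi_L_le_lo_M l
  have h3 := lo_lt_hi (l ++ [M])
  have h4 := hi_M_le_lo_R l
  cases c
  · exact absurd rfl hc
  · linarith
  · linarith

theorem hi_concat_lt_hi (l : List LMR) {c : LMR} (hc : c ≠ R) : hi (l ++ [c]) < hi l := by
  have h2 := hi_L_le_lo_M l
  have h3 := lo_lt_hi (l ++ [M])
  have h4 := hi_M_le_lo_R l
  have h5 := lo_R_lt_hi l
  cases c
  · linarith
  · linarith
  · exact absurd rfl hc

theorem lo_le_lo_concat (l : List LMR) (c : LMR) : lo l ≤ lo (l ++ [c]) := by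
  by_cases hc : c = L
  · rw [hc, lo_L]
  · exact (lo_lt_lo_concat l hc).le

theorem hi_concat_le_hi (l : List LMR) (c : LMR) : hi (l ++ [c]) ≤ hi l := by
  by_cases hc : c = R
  · rw [hc, hi_R]
  · exact (hi_concat_lt_hi l hc).le

/-- The open interval attached to a list of substitutions. -/
def cell (l : List LMR) : Set ℝ := Set.Ioo (lo l) (hi l)

/-- The part of a cell not covered by the three cells below it. -/
def gaps (l : List LMR) : Set ℝ :=
  Set.Icc (hi (l ++ [L])) (lo (l ++ [M])) ∪ Set.Icc (hi (l ++ [M])) (lo (l ++ [R]))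

theorem cell_append_subset (p r : List LMR) : cell (p ++ r) ⊆ cell p := by
  induction r generalizing p with
  | nil => simp
  | cons c r ih =>
    have h := ih (p ++ [c])
    rw [List.append_assoc, List.singleton_append] at h
    exact h.trans (Set.Ioo_subset_Ioo (lo_le_lo_concat p c) (hi_concat_le_hi p c))

theorem gaps_subset_cell (l : List LMR) : gaps l ⊆ cell l := by
  have h1 := lo_lt_hi_L l
  have h2 := hi_L_le_lo_M l
  have h3 := lo_lt_hi (l ++ [M])
  have h4 := hi_M_le_lo_R l
  have h5 := lo_R_lt_hi l
  rintro x (⟨hx, hx'⟩ | ⟨hx, hx'⟩) <;> constructor <;> linarith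

theorem not_mem_cell_concat_of_mem_gaps {l : List LMR} {x : ℝ} (hx : x ∈ gaps l) (c : LMR) :
    x ∉ cell (l ++ [c]) := by
  have h2 := hi_L_le_lo_M l
  have h3 := lo_lt_hi (l ++ [M])
  have h4 := hi_M_le_lo_R l
  rintro ⟨h, h'⟩
  rcases hx with ⟨hx, hx'⟩ | ⟨hx, hx'⟩ <;> cases c <;> linarith

theorem eq_of_mem_cell_concat {l : List LMR} {x : ℝ} {c d : LMR} (hc : x ∈ cell (l ++ [c]))
    (hd : x ∈ cell (l ++ [d])) : c = d := by
  have h2 := hi_L_le_lo_M l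
  have h3 := lo_lt_hi (l ++ [M])
  have h4 := hi_M_le_lo_R l
  obtain ⟨hc, hc'⟩ := hc
  obtain ⟨hd, hd'⟩ := hd
  cases c <;> cases d <;> first
    | rfl
    | exfalso; linarith

theorem not_mem_cell_of_mem_gaps {l l' : List LMR} (hne : l ≠ l') (hlen : l.length ≤ l'.length)
    {x : ℝ} (hx : x ∈ gaps l) : x ∉ cell l' := by
  suffices ∀ p : List LMR, x ∈ gaps (p ++ l) → x ∉ cell (p ++ l') from this [] hx
  clear hx
  induction l generalizing l' with
  | nil =>
    intro p hx hx'
    obtain ⟨c, r, rfl⟩ := List.exists_cons_of_ne_nil hne.symm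
    rw [List.append_cons] at hx'
    rw [List.append_nil] at hx
    exact not_mem_cell_concat_of_mem_gaps hx c (cell_append_subset _ _ hx')
  | cons a l ih =>
    intro p hx hx'
    cases l' with
    | nil => simp at hlen
    | cons c r =>
      rw [List.append_cons] at hx hx'
      obtain rfl := eq_of_mem_cell_concat
        (cell_append_subset _ _ (gaps_subset_cell _ hx)) (cell_append_subset _ _ hx')
      exact ih (fun h => hne (by rw [h])) (by simpa using hlen) _ hx hx'

theorem disjoint_gaps {l l' : List LMR} (hne : l ≠ l') : Disjoint (gaps l) (gaps l') := by
  rw [Set.disjoint_left]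
  intro x hx hx'
  rcases le_total l.length l'.length with h | h
  · exact not_mem_cell_of_mem_gaps hne h hx (gaps_subset_cell _ hx')
  · exact not_mem_cell_of_mem_gaps hne.symm h hx' (gaps_subset_cell _ hx)

theorem exists_mem_cell_concat {l : List LMR} {x : ℝ} (hx : x ∈ cell l) (hx' : x ∉ gaps l) :
    ∃ c, x ∈ cell (l ++ [c]) := by
  simp only [gaps, Set.mem_union, Set.mem_Icc, not_or, not_and, not_le] at hx'
  obtain ⟨h1, h2⟩ := hx
  rcases lt_or_ge x (hi (l ++ [L])) with h | h
  · exact ⟨L, (lo_L l).trans_lt h1, h⟩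
  rcases lt_or_ge x (hi (l ++ [M])) with h' | h'
  · exact ⟨M, hx'.1 h, h'⟩
  · exact ⟨R, hx'.2 h', h2.trans_eq (hi_R l).symm⟩

/-! ### Limit words -/

/-- The first `n` terms of a sequence of labels. -/
def initialSegment (s : ℕ → LMR) (n : ℕ) : List LMR := (List.range n).map s

theorem initialSegment_succ (s : ℕ → LMR) (n : ℕ) :
    initialSegment s (n + 1) = initialSegment s n ++ [s n] := by
  simp [initialSegment, List.range_succ]

theorem length_initialSegment (s : ℕ → LMR) (n : ℕ) : (initialSegment s n).length = n := by
  simp [initialSegment]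

/-- Neither `L` nor `R` is eventually the only label. -/
def PrimitiveLabels (s : ℕ → LMR) : Prop :=
  (∀ k, ∃ n, k ≤ n ∧ s n ≠ L) ∧ ∀ k, ∃ n, k ≤ n ∧ s n ≠ R

/-- `w n` is the image of `w (n + 1)` under the substitution with label `s n`. -/
def Desubstitutes (s : ℕ → LMR) (w : ℕ → ℕ → Bool) : Prop := ∀ n, w n = ap (s n) (w (n + 1))

theorem Desubstitutes.eq_aps {s : ℕ → LMR} {w : ℕ → ℕ → Bool} (h : Desubstitutes s w) (n : ℕ) :
    w 0 = aps (initialSegment s n) (w n) := by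
  induction n with
  | zero => rfl
  | succ n ih => rw [initialSegment_succ, aps_concat, ← h n, ih]

/-- Both `01` and `10` are factors of the word. -/
def Mixed (u : ℕ → Bool) : Prop :=
  (∃ y, consB false (consB true y) ∈ orbit u) ∧ ∃ y, consB true (consB false y) ∈ orbit u

theorem mixed_ap_of_ne_R {c : LMR} (hc : c ≠ R) {u : ℕ → Bool}
    (h0 : ∃ y, consB false y ∈ orbit u) (h1 : ∃ y, consB true y ∈ orbit u) :
    Mixed (ap c u) := by
  obtain ⟨y, hy⟩ := h0
  obtain ⟨z, hz⟩ := h1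
  replace hy := mem_orbit_ap c hy
  replace hz := mem_orbit_ap c hz
  cases c
  · obtain ⟨t, ht⟩ := eq_consB_of_zero (ap_L_zero z)
    rw [ap_L_true] at hz
    exact ⟨⟨_, hz⟩, t, by rw [← ht]; exact mem_orbit_of_consB hz⟩
  · rw [ap_M_false] at hy
    rw [ap_M_true] at hz
    exact ⟨⟨_, hy⟩, _, hz⟩
  · exact absurd rfl hc

theorem Mixed.ap {u : ℕ → Bool} (h : Mixed u) (c : LMR) : Mixed (ap c u) := by
  obtain ⟨⟨y, hy⟩, z, hz⟩ := h
  by_cases hc : c = R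
  · subst hc
    replace hy := mem_orbit_ap R hy
    replace hz := mem_orbit_ap R hz
    rw [ap_R_false] at hy
    rw [ap_R_true, ap_R_false] at hz
    exact ⟨⟨_, hy⟩, _, hz⟩
  · exact mixed_ap_of_ne_R hc ⟨_, hy⟩ ⟨_, hz⟩

theorem Mixed.orbitBetweenInner {u : ℕ → Bool} (h : Mixed u) :
    OrbitBetweenInner u leftPair rightPair := by
  obtain ⟨⟨y, hy⟩, z, hz⟩ := h
  refine ⟨fun x _ => ⟨w0bar_lexLe x, lexLe_w1bar x⟩, ⟨_, hy, ?_⟩, _, hz, ?_⟩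
  · simpa only [leftPair, w10bar_eq, lexLe_consB] using w0bar_lexLe y
  · simpa only [rightPair, w01bar_eq, lexLe_consB] using lexLe_w1bar z

theorem exists_false_mem_orbit_ap (c : LMR) {x y : ℕ → Bool} (hy : consB false y ∈ orbit x) :
    ∃ z, consB false z ∈ orbit (ap c x) := by
  have := mem_orbit_ap c hy
  cases c
  · rw [ap_L_false] at this; exact ⟨_, this⟩
  · rw [ap_M_false] at this; exact ⟨_, this⟩
  · rw [ap_R_false] at this; exact ⟨_, this⟩

theorem exists_true_mem_orbit_ap_of_ne_L {c : LMR} (hc : c ≠ L) (u : ℕ → Bool) :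
    ∃ z, consB true z ∈ orbit (ap c u) := by
  obtain ⟨b, v, rfl⟩ := exists_consB u
  cases c
  · exact absurd rfl hc
  · cases b
    · rw [ap_M_false]
      exact ⟨_, mem_orbit_of_consB (mem_orbit_self _)⟩
    · rw [ap_M_true]
      exact ⟨_, mem_orbit_self _⟩
  · cases b
    · rw [ap_R_false]
      exact ⟨_, mem_orbit_of_consB (mem_orbit_self _)⟩
    · rw [ap_R_true]
      exact ⟨_, mem_orbit_self _⟩

theorem exists_false_mem_orbit_ap_of_ne_R {c : LMR} (hc : c ≠ R) (u : ℕ → Bool) :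
    ∃ z, consB false z ∈ orbit (ap c u) := by
  obtain ⟨b, v, rfl⟩ := exists_consB u
  cases c
  · cases b
    · rw [ap_L_false]
      exact ⟨_, mem_orbit_self _⟩
    · rw [ap_L_true]
      exact ⟨_, mem_orbit_self _⟩
  · cases b
    · rw [ap_M_false]
      exact ⟨_, mem_orbit_self _⟩
    · rw [ap_M_true]
      exact ⟨_, mem_orbit_of_consB (mem_orbit_self _)⟩
  · exact absurd rfl hc

theorem forall_of_succ_of_frequently {P : ℕ → Prop} (h : ∀ n, P (n + 1) → P n)
    (h' : ∀ n, ∃ k, n ≤ k ∧ P k) (n : ℕ) : P n := by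
  obtain ⟨k, hnk, hk⟩ := h' n
  exact Nat.decreasingInduction (motive := fun m _ => P m) (fun m _ hm => h m hm) hk hnk

theorem Desubstitutes.mixed {s : ℕ → LMR} {w : ℕ → ℕ → Bool} (h : Desubstitutes s w)
    (hs : PrimitiveLabels s) (n : ℕ) : Mixed (w n) := by
  have h1 : ∀ n, ∃ y, consB true y ∈ orbit (w n) := by
    refine forall_of_succ_of_frequently (fun n hn => ?_) (fun n => ?_)
    · obtain ⟨y, hy⟩ := hn
      rw [h n]
      exact exists_true_mem_orbit_ap _ hy
    · obtain ⟨k, hk, hk'⟩ := hs.1 n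
      exact ⟨k, hk, by rw [h k]; exact exists_true_mem_orbit_ap_of_ne_L hk' _⟩
  have h0 : ∀ n, ∃ y, consB false y ∈ orbit (w n) := by
    refine forall_of_succ_of_frequently (fun n hn => ?_) (fun n => ?_)
    · obtain ⟨y, hy⟩ := hn
      rw [h n]
      exact exists_false_mem_orbit_ap _ hy
    · obtain ⟨k, hk, hk'⟩ := hs.2 n
      exact ⟨k, hk, by rw [h k]; exact exists_false_mem_orbit_ap_of_ne_R hk' _⟩
  refine forall_of_succ_of_frequently (P := fun n => Mixed (w n)) (fun n hn => ?_)
    (fun n => ?_) n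
  · rw [h n]
    exact hn.ap _
  · obtain ⟨k, hk, hk'⟩ := hs.2 n
    exact ⟨k, hk, by rw [h k]; exact mixed_ap_of_ne_R hk' (h0 _) (h1 _)⟩

theorem Desubstitutes.muVal_mem_Icc {s : ℕ → LMR} {w : ℕ → ℕ → Bool} (h : Desubstitutes s w)
    (hs : PrimitiveLabels s) (n : ℕ) :
    muVal (w 0) ∈ Set.Icc (lo (initialSegment s n)) (hi (initialSegment s n)) := by
  have hb : ∀ n, OrbitBetween (w 0) (acts (initialSegment s n) leftPair)
      (acts (initialSegment s n) rightPair) := fun n => by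
    rw [h.eq_aps n]
    exact ((h.mixed hs n).orbitBetweenInner.aps admissible_leftPair admissible_rightPair
      _).orbitBetween
  obtain ⟨k, -, hk⟩ := hs.1 0
  have hlt : lexLt w10bar (acts (initialSegment s (k + 1)) leftPair).1 := by
    rw [initialSegment_succ, acts_concat]
    apply lexLt_w10bar_acts
    cases hk' : s k
    · exact absurd hk' hk
    · rw [act_M_leftPair, w10bar_eq, lexLt_consB]
      exact lexLt_w0bar_consB_true _
    · rw [act_R_leftPair, w10bar_eq, lexLt_consB]
      exact lexLt_w0bar_consB_true _
  exact (hb n).muVal_mem (admissible_acts _ admissible_leftPair)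
    (admissible_acts _ admissible_rightPair) (hlt.trans_le (hb (k + 1)).lexLe.1.1)

theorem monotone_lo_initialSegment (s : ℕ → LMR) : Monotone fun n => lo (initialSegment s n) :=
  monotone_nat_of_le_succ fun n => by
    rw [initialSegment_succ]; exact lo_le_lo_concat _ _

theorem antitone_hi_initialSegment (s : ℕ → LMR) : Antitone fun n => hi (initialSegment s n) :=
  antitone_nat_of_succ_le fun n => by
    rw [initialSegment_succ]; exact hi_concat_le_hi _ _

theorem Desubstitutes.muVal_mem_cell {s : ℕ → LMR} {w : ℕ → ℕ → Bool} (h : Desubstitutes s w)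
    (hs : PrimitiveLabels s) (n : ℕ) : muVal (w 0) ∈ cell (initialSegment s n) := by
  constructor
  · obtain ⟨k, hnk, hk⟩ := hs.1 n
    calc lo (initialSegment s n) ≤ lo (initialSegment s k) := monotone_lo_initialSegment s hnk
      _ < lo (initialSegment s (k + 1)) := by
        rw [initialSegment_succ]; exact lo_lt_lo_concat _ hk
      _ ≤ muVal (w 0) := (h.muVal_mem_Icc hs (k + 1)).1
  · obtain ⟨k, hnk, hk⟩ := hs.2 n
    calc muVal (w 0) ≤ hi (initialSegment s (k + 1)) := (h.muVal_mem_Icc hs (k + 1)).2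
      _ < hi (initialSegment s k) := by
        rw [initialSegment_succ]; exact hi_concat_lt_hi _ hk
      _ ≤ hi (initialSegment s n) := antitone_hi_initialSegment s hnk

theorem continuous_ap (c : LMR) : Continuous (ap c) := by
  refine continuous_pi fun i => IsLocallyConstant.continuous ?_
  rw [IsLocallyConstant.iff_eventually_eq]
  intro x
  have : ∀ᶠ y in nhds x, ∀ j ∈ Set.Iio (i + 1), y j = x j := by
    rw [Filter.eventually_all_finite (Set.finite_Iio _)]
    intro j _
    exact (continuous_apply j).tendsto x ((isOpen_discrete {x j}).mem_nhds rfl)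
  filter_upwards [this] with y hy
  exact agree_ap c hy i (Nat.lt_succ_self i)

theorem exists_desubstitutes (s : ℕ → LMR) : ∃ w, Desubstitutes s w := by
  let K : ℕ → Set (ℕ → ℕ → Bool) := fun n => {w | ∀ k < n, w k = ap (s k) (w (k + 1))}
  have hK : (⋂ n, K n).Nonempty := by
    have hclosed : ∀ n, IsClosed (K n) := fun n => by
      have : K n = ⋂ k, ⋂ _ : k < n, {w | w k = ap (s k) (w (k + 1))} := by
        ext w; simp [K]
      rw [this]
      exact isClosed_iInter fun k => isClosed_iInter fun _ =>
        isClosed_eq (continuous_apply k) ((continuous_ap _).comp (continuous_apply (k + 1)))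
    refine IsCompact.nonempty_iInter_of_sequence_nonempty_isCompact_isClosed K
      (fun n w hw k hk => hw k (by omega)) (fun n => ?_) (hclosed 0).isCompact hclosed
    refine ⟨fun k => aps ((List.range' k (n - k)).map s) w0bar, fun k hk => ?_⟩
    obtain ⟨m, hm⟩ : ∃ m, n - k = m + 1 := ⟨n - k - 1, by omega⟩
    have hm' : n - (k + 1) = m := by omega
    simp only [hm, hm', List.range'_succ, List.map_cons, aps, List.foldr_cons]
  obtain ⟨w, hw⟩ := hK
  exact ⟨w, fun n => Set.mem_iInter.1 hw (n + 1) n (Nat.lt_succ_self n)⟩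

theorem sub_injective : Function.Injective sub := by
  intro c d h
  have h0 := congrFun h false
  have h1 := congrFun h true
  cases c <;> cases d <;> simp [sub, Lsub, Msub, Rsub] at h0 h1 ⊢

theorem mem_Sset_iff {u : ℕ → Bool} :
    u ∈ Sset ↔ ∃ s w, PrimitiveLabels s ∧ Desubstitutes s w ∧ w 0 = u := by
  constructor
  · rintro ⟨σ, hσ, ⟨hL, hR⟩, w, hw0, hw⟩
    have : ∀ n, ∃ c : LMR, σ n = c.sub := fun n => by
      rcases hσ n with h | h | h
      exacts [⟨L, h⟩, ⟨M, h⟩, ⟨R, h⟩]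
    choose s hs using this
    refine ⟨s, w, ⟨fun k => ?_, fun k => ?_⟩, fun n => by rw [hw n, hs n]; rfl, hw0⟩
    · by_contra! hc
      exact hL ⟨k, fun n hn => by rw [hs n, hc n hn]; rfl⟩
    · by_contra! hc
      exact hR ⟨k, fun n hn => by rw [hs n, hc n hn]; rfl⟩
  · rintro ⟨s, w, ⟨hL, hR⟩, hw, rfl⟩
    refine ⟨fun n => (s n).sub, fun n => ?_, ⟨?_, ?_⟩, w, rfl, hw⟩
    · beta_reduce
      cases s n <;> simp [sub]
    · rintro ⟨k, hk⟩
      obtain ⟨n, hn, hn'⟩ := hL k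
      exact hn' (sub_injective (hk n hn))
    · rintro ⟨k, hk⟩
      obtain ⟨n, hn, hn'⟩ := hR k
      exact hn' (sub_injective (hk n hn))

theorem le_of_forall_le_add_pow {x y : ℝ} {k : ℕ}
    (h : ∀ n, k ≤ n → x ≤ y + 3 * (1 / 2) ^ (n + 1)) : x ≤ y := by
  refine le_of_forall_pos_le_add fun ε hε => ?_
  obtain ⟨n, hn⟩ := exists_pow_lt_of_lt_one (show 0 < ε / 3 by positivity)
    (show (1 / 2 : ℝ) < 1 by norm_num)
  have h1 := h (k + n) (by omega)
  have h2 : (1 / 2 : ℝ) ^ (k + n + 1) ≤ (1 / 2) ^ n :=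
    pow_le_pow_of_le_one (by norm_num) (by norm_num) (by omega)
  linarith

theorem hi_initialSegment_le (s : ℕ → LMR) (n : ℕ) :
    hi (initialSegment s n) ≤ lo (initialSegment s n) + 3 * (1 / 2) ^ (n + 1) := by
  simpa [length_initialSegment] using hi_le_lo_add (initialSegment s n)

theorem primitiveLabels_of_mem_cell {s : ℕ → LMR} {x : ℝ}
    (hx : ∀ n, x ∈ cell (initialSegment s n)) : PrimitiveLabels s := by
  constructor
  · intro k
    by_contra! hc
    have hlo : ∀ n, k ≤ n → lo (initialSegment s n) = lo (initialSegment s k) := fun n hn => by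
      induction n, hn using Nat.le_induction with
      | base => rfl
      | succ n hn ih => rw [initialSegment_succ, hc n hn, lo_L, ih]
    refine (hx k).1.not_ge (le_of_forall_le_add_pow (k := k) fun n hn => ?_)
    rw [← hlo n hn]
    exact (hx n).2.le.trans (hi_initialSegment_le s n)
  · intro k
    by_contra! hc
    have hhi : ∀ n, k ≤ n → hi (initialSegment s n) = hi (initialSegment s k) := fun n hn => by
      induction n, hn using Nat.le_induction with
      | base => rfl
      | succ n hn ih => rw [initialSegment_succ, hc n hn, hi_R, ih]
    refine (hx k).2.not_ge (le_of_forall_le_add_pow (k := k) fun n hn => ?_)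
    rw [← hhi n hn]
    have := hi_initialSegment_le s n
    have := (hx n).1
    linarith

theorem exists_muVal_eq_of_mem_cell {s : ℕ → LMR} {x : ℝ}
    (hx : ∀ n, x ∈ cell (initialSegment s n)) : ∃ u ∈ Sset, x = muVal u := by
  have hs := primitiveLabels_of_mem_cell hx
  obtain ⟨w, hw⟩ := exists_desubstitutes s
  refine ⟨w 0, mem_Sset_iff.2 ⟨s, w, hs, hw, rfl⟩, le_antisymm ?_ ?_⟩
  · refine le_of_forall_le_add_pow (k := 0) fun n _ => ?_
    have := hi_initialSegment_le s n
    have := (hx n).2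
    have := (hw.muVal_mem_Icc hs n).1
    linarith
  · refine le_of_forall_le_add_pow (k := 0) fun n _ => ?_
    have := hi_initialSegment_le s n
    have := (hx n).1
    have := (hw.muVal_mem_Icc hs n).2
    linarith

theorem exists_mem_cell_initialSegment {x : ℝ} (hx : x ∈ cell []) (hx' : ∀ l, x ∉ gaps l) :
    ∃ s : ℕ → LMR, ∀ n, x ∈ cell (initialSegment s n) := by
  choose c hc using fun l : {l // x ∈ cell l} => exists_mem_cell_concat l.2 (hx' l.1)
  let P : ℕ → {l // x ∈ cell l} := fun n =>
    Nat.rec ⟨[], hx⟩ (fun _ l => ⟨l.1 ++ [c l], hc l⟩) n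
  have hP : ∀ n, initialSegment (fun n => c (P n)) n = (P n).1 := fun n => by
    induction n with
    | zero => rfl
    | succ n ih => rw [initialSegment_succ, ih]
  exact ⟨fun n => c (P n), fun n => by rw [hP]; exact (P n).2⟩

/-! ### The partition -/

/-- The element of `{L,M,R}*M` attached to a list of labels. -/
def starM (l : List LMR) : Bool → List Bool :=
  compSub ((l.map sub).foldr compSub idSub) Msub

theorem exists_eq_starM_iff {σ : Bool → List Bool} :
    (∃ τ ∈ LMRstar, σ = compSub τ Msub) ↔ ∃ l, starM l = σ := by
  constructor
  · rintro ⟨τ, ⟨l, hl, rfl⟩, rfl⟩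
    have : l ∈ Set.range (List.map sub) := by
      rw [Set.range_list_map]
      intro τ hτ
      rcases hl τ hτ with rfl | rfl | rfl
      exacts [⟨L, rfl⟩, ⟨M, rfl⟩, ⟨R, rfl⟩]
    obtain ⟨l, rfl⟩ := this
    exact ⟨l, rfl⟩
  · rintro ⟨l, rfl⟩
    refine ⟨_, ⟨l.map sub, fun τ hτ => ?_, rfl⟩, rfl⟩
    obtain ⟨c, -, rfl⟩ := List.mem_map.1 hτ
    cases c <;> simp [sub]

theorem substApply_starM (l : List LMR) (u : ℕ → Bool) :
    substApply (starM l) u = aps l (ap M u) := by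
  have hn : ∀ l : List LMR, Nonerasing ((l.map sub).foldr compSub idSub) := fun l => by
    induction l with
    | nil => exact nonerasing_idSub
    | cons c l ih => exact (nonerasing_sub c).compSub ih
  refine (substApply_compSub (hn l) (nonerasing_sub M) u).trans ?_
  change substApply _ (ap M u) = _
  generalize ap M u = v
  induction l with
  | nil => exact substApply_idSub v
  | cons c l ih =>
    rw [List.map_cons, List.foldr_cons, substApply_compSub (nonerasing_sub c) (hn l), ih]
    rfl

/-- The interval `(1, μ_{0 1̄})` is partitioned by `{μ_u : u ∈ S_{L,M,R}}` together with the
intervals `[μ_{σ(1 0̄)}, μ_{σ(01 0̄)}]` and `[μ_{σ(10 1̄)}, μ_{σ(0 1̄)}]`, `σ ∈ {L,M,R}*M`. -/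
theorem mu_partition :
    (Set.Ioo (1 : ℝ) (muVal w01bar) =
      {x : ℝ | ∃ u ∈ Sset, x = muVal u} ∪
        ⋃ σ ∈ {σ : Bool → List Bool | ∃ τ ∈ LMRstar, σ = compSub τ Msub},
          (Set.Icc (muVal (substApply σ w10bar)) (muVal (substApply σ w010bar)) ∪
            Set.Icc (muVal (substApply σ w101bar)) (muVal (substApply σ w01bar)))) ∧
    (∀ u ∈ Sset, ∀ σ : Bool → List Bool, (∃ τ ∈ LMRstar, σ = compSub τ Msub) →
      muVal u ∉ Set.Icc (muVal (substApply σ w10bar)) (muVal (substApply σ w010bar)) ∧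
      muVal u ∉ Set.Icc (muVal (substApply σ w101bar)) (muVal (substApply σ w01bar))) ∧
    (∀ σ : Bool → List Bool, (∃ τ ∈ LMRstar, σ = compSub τ Msub) →
      Disjoint (Set.Icc (muVal (substApply σ w10bar)) (muVal (substApply σ w010bar)))
        (Set.Icc (muVal (substApply σ w101bar)) (muVal (substApply σ w01bar)))) ∧
    (∀ σ σ' : Bool → List Bool,
      (∃ τ ∈ LMRstar, σ = compSub τ Msub) → (∃ τ ∈ LMRstar, σ' = compSub τ Msub) → σ ≠ σ' →
      Disjoint
        (Set.Icc (muVal (substApply σ w10bar)) (muVal (substApply σ w010bar)) ∪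
          Set.Icc (muVal (substApply σ w101bar)) (muVal (substApply σ w01bar)))
        (Set.Icc (muVal (substApply σ' w10bar)) (muVal (substApply σ' w010bar)) ∪
          Set.Icc (muVal (substApply σ' w101bar)) (muVal (substApply σ' w01bar)))) := by
  have hgaps : ∀ l, Set.Icc (muVal (substApply (starM l) w10bar))
      (muVal (substApply (starM l) w010bar)) ∪ Set.Icc (muVal (substApply (starM l) w101bar))
      (muVal (substApply (starM l) w01bar)) = gaps l := fun l => by
    simp only [substApply_starM, muVal_aps_M_w10bar, muVal_aps_M_w010bar, muVal_aps_M_w101bar,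
      muVal_aps_M_w01bar, gaps]
  have hcell : Set.Ioo 1 (muVal w01bar) = cell [] := by rw [cell, lo_nil, muVal_w01bar]
  simp only [exists_eq_starM_iff]
  refine ⟨?_, ?_, ?_, ?_⟩
  · rw [hcell]
    ext x
    simp only [Set.mem_union, Set.mem_iUnion, Set.mem_ofPred_eq]
    constructor
    · intro hx
      by_cases h : ∃ l, x ∈ gaps l
      · obtain ⟨l, hl⟩ := h
        rw [← hgaps] at hl
        exact Or.inr ⟨_, ⟨l, rfl⟩, hl⟩
      · push Not at h
        obtain ⟨s, hs⟩ := exists_mem_cell_initialSegment hx h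
        exact Or.inl (exists_muVal_eq_of_mem_cell hs)
    · rintro (⟨u, hu, rfl⟩ | ⟨_, ⟨l, rfl⟩, hl⟩)
      · obtain ⟨s, w, hs, hw, rfl⟩ := mem_Sset_iff.1 hu
        exact hw.muVal_mem_cell hs 0
      · have h : x ∈ gaps l := by rw [← hgaps]; exact hl
        exact cell_append_subset [] l (gaps_subset_cell l h)
  · rintro u hu _ ⟨l, rfl⟩
    rw [← not_or, ← Set.mem_union, hgaps]
    obtain ⟨s, w, hs, hw, rfl⟩ := mem_Sset_iff.1 hu
    have hlen := length_initialSegment s (l.length + 1)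
    exact fun h => not_mem_cell_of_mem_gaps (l' := initialSegment s (l.length + 1))
      (fun he => by rw [← he] at hlen; omega) (by omega) h (hw.muVal_mem_cell hs _)
  · rintro _ ⟨l, rfl⟩
    simp only [substApply_starM, muVal_aps_M_w10bar, muVal_aps_M_w010bar, muVal_aps_M_w101bar,
      muVal_aps_M_w01bar]
    rw [Set.disjoint_left]
    exact fun x hx hx' => absurd (hx'.1.trans hx.2) (lo_lt_hi (l ++ [M])).not_ge
  · rintro _ _ ⟨l, rfl⟩ ⟨l', rfl⟩ hne
    rw [hgaps, hgaps]
    exact disjoint_gaps fun h => hne (by rw [h])
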